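/- arXiv:1609.01510 — 12 statements merged into one kernel-verified Lean document; each statement's English description precedes it below -/
import Mathlib

section
/- Let G be a connected finite simple graph with at least two vertices and let D be a minimal dominating set of G. Then there exists a minimal dominating set D' of G with |D'| ≤ |D| such that every vertex of D' has a private neighbour outside of D'. -/
/-- A set `D` of vertices is dominating if every vertex not in `D` has a neighbour in `D`. -/
def Dominating {V : Type*} (G : SimpleGraph V) (D : Set V) : Prop :=
  ∀ v ∉ D, ∃ u ∈ D, G.Adj u v

/-- `D` is a minimal dominating set if it is dominating and no proper subset is dominating. -/
def MinimalDominating {V : Type*} (G : SimpleGraph V) (D : Set V) : Prop :=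
  Dominating G D ∧ ∀ D' ⊂ D, ¬ Dominating G D'

/-- For `x ∈ D`, a vertex `y ∉ D` is a private neighbour of `x` (w.r.t. `D`) if `x` is the
only neighbour of `y` in `D`. -/
def PrivateNbr {V : Type*} (G : SimpleGraph V) (D : Set V) (x y : V) : Prop :=
  x ∈ D ∧ y ∉ D ∧ G.Adj x y ∧ ∀ z ∈ D, G.Adj z y → z = x

/-- In a connected finite graph with at least two vertices, every minimal dominating set `D`
can be replaced by a minimal dominating set `D'` with `|D'| ≤ |D|` in which every vertex has
a private neighbour outside of `D'`. -/
theorem exists_minimalDominating_all_private {V : Type*} [Fintype V] (G : SimpleGraph V)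
    (hc : G.Connected) (hcard : 2 ≤ Fintype.card V)
    (D : Set V) (hD : MinimalDominating G D) :
    ∃ D' : Set V, MinimalDominating G D' ∧ D'.ncard ≤ D.ncard ∧
      ∀ x ∈ D', ∃ y, PrivateNbr G D' x y := by
  classical
  have : Nontrivial V := Fintype.one_lt_card_iff_nontrivial.mp (by omega)
  -- a dominating set of minimum size
  obtain ⟨M, hM, hMmin⟩ := Set.exists_min_image {S : Set V | Dominating G S} Set.ncard
    (Set.toFinite _) ⟨D, hD.1⟩
  -- among those, one with the fewest isolated vertices
  obtain ⟨S, ⟨hS, hSM⟩, hSmin⟩ := Set.exists_min_image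
    {S : Set V | Dominating G S ∧ S.ncard = M.ncard}
    (fun S => {x | x ∈ S ∧ ∀ z ∈ S, ¬ G.Adj z x}.ncard) (Set.toFinite _) ⟨M, hM, rfl⟩
  have hmin : MinimalDominating G S := by
    refine ⟨hS, fun T hT hTd => ?_⟩
    have h1 := Set.ncard_lt_ncard hT (Set.toFinite _)
    have h2 := hMmin T hTd
    omega
  refine ⟨S, hmin, hSM ▸ hMmin D hD.1, fun x hx => ?_⟩
  by_contra hno
  have hpriv : ∀ v, v ∉ S → G.Adj x v → ∃ z ∈ S, G.Adj z v ∧ z ≠ x := by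
    intro v hv hxv
    by_contra hcon
    push Not at hcon
    exact hno ⟨v, hx, hv, hxv, hcon⟩
  -- `x` is isolated in `S`
  have hiso : ∀ z ∈ S, ¬ G.Adj z x := by
    intro z hz hzx
    refine hmin.2 (S \ {x}) ⟨Set.diff_subset, fun h => (h hx).2 rfl⟩ ?_
    intro v hv
    by_cases hvx : v = x
    · subst hvx
      exact ⟨z, ⟨hz, hzx.ne⟩, hzx⟩
    · have hvS : v ∉ S := fun h => hv ⟨h, hvx⟩
      obtain ⟨u, hu, huv⟩ := hS v hvS
      by_cases hux : u = x
      · subst hux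
        obtain ⟨w, hw, hwv, hwx⟩ := hpriv v hvS huv
        exact ⟨w, ⟨hw, hwx⟩, hwv⟩
      · exact ⟨u, ⟨hu, hux⟩, huv⟩
  obtain ⟨y, hxy⟩ := hc.preconnected.exists_adj_of_nontrivial x
  have hyS : y ∉ S := fun h => hiso y h hxy.symm
  obtain ⟨w, hw, hwy, hwx⟩ := hpriv y hyS hxy
  -- exchange `x` for `y`
  have hT : Dominating G (insert y (S \ {x})) := by
    intro v hv
    by_cases hvx : v = x
    · subst hvx
      exact ⟨y, Or.inl rfl, hxy.symm⟩
    · have hvS : v ∉ S := fun h => hv (Or.inr ⟨h, hvx⟩)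
      obtain ⟨u, hu, huv⟩ := hS v hvS
      by_cases hux : u = x
      · subst hux
        obtain ⟨w, hw, hwv, hwx⟩ := hpriv v hvS huv
        exact ⟨w, Or.inr ⟨hw, hwx⟩, hwv⟩
      · exact ⟨u, Or.inr ⟨hu, hux⟩, huv⟩
  have hle := hSmin _ ⟨hT, (Set.ncard_exchange hyS hx).trans hSM⟩
  refine absurd (Set.ncard_lt_ncard ?_ (Set.toFinite _)) (not_lt.mpr hle)
  refine ⟨?_, fun h => ?_⟩
  · rintro a ⟨ha, haiso⟩
    rcases ha with rfl | ⟨haS, hax⟩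
    · exact absurd hwy (haiso w (Or.inr ⟨hw, hwx⟩))
    · refine ⟨haS, fun z hz hza => ?_⟩
      by_cases hzx : z = x
      · subst hzx
        exact hiso a haS hza.symm
      · exact haiso z (Or.inr ⟨hz, hzx⟩) hza
  · rcases (h ⟨hx, hiso⟩).1 with h1 | h1
    · exact hxy.ne h1
    · exact h1.2 rfl
end

section
/- Let G = (V,E) be a finite simple graph with m edges, let G' be the graph obtained from G by replacing each edge by two paths as described, and let k be a natural number. Then G has an independent set of size at least k if and only if G' has a minimal dominating set of size at least k + 2m. -/
/-- An independent set is a set of pairwise non-adjacent vertices. -/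
def IndepSet {V : Type*} (G : SimpleGraph V) (S : Set V) : Prop :=
  ∀ u ∈ S, ∀ v ∈ S, ¬ G.Adj u v

/-- The vertex set of the graph `G'` obtained from `G` by replacing each edge `e = uv` by two
induced paths `u - v_e - u_e - v` and `u - v'_e - u'_e - v`: the old vertices together with,
for every ordered adjacent pair `(u,v)` and every Boolean `i`, a new internal vertex
(the internal vertex of path `i` of edge `{u,v}` which is adjacent to `u`). -/
abbrev GadgetVert {V : Type*} (G : SimpleGraph V) : Type _ :=
  V ⊕ ({ p : V × V // G.Adj p.1 p.2 } × Bool)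

/-- The graph `G'` obtained from `G` by replacing each edge `e = uv` by the two induced paths
`u - v_e - u_e - v` and `u - v'_e - u'_e - v`. -/
def EdgePaths {V : Type*} (G : SimpleGraph V) : SimpleGraph (GadgetVert G) :=
  SimpleGraph.fromRel (fun x y =>
    match x, y with
    | Sum.inl u, Sum.inr ⟨⟨⟨a, _⟩, _⟩, _⟩ => u = a
    | Sum.inr ⟨⟨⟨a, b⟩, _⟩, i⟩, Sum.inr ⟨⟨⟨c, d⟩, _⟩, j⟩ => i = j ∧ a = d ∧ b = c
    | _, _ => False)

lemma ep_adj_ll {V : Type*} (G : SimpleGraph V) (u v : V) :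
    ¬ (EdgePaths G).Adj (Sum.inl u) (Sum.inl v) := by
  simp [EdgePaths]

lemma ep_adj_lr {V : Type*} (G : SimpleGraph V) (u a b : V) (h : G.Adj a b) (i : Bool) :
    (EdgePaths G).Adj (Sum.inl u) (Sum.inr (⟨(a, b), h⟩, i)) ↔ u = a := by
  simp [EdgePaths]

lemma ep_adj_rl {V : Type*} (G : SimpleGraph V) (u a b : V) (h : G.Adj a b) (i : Bool) :
    (EdgePaths G).Adj (Sum.inr (⟨(a, b), h⟩, i)) (Sum.inl u) ↔ u = a := by
  simp [EdgePaths]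

lemma ep_adj_rr {V : Type*} (G : SimpleGraph V) (a b c d : V) (h : G.Adj a b) (h2 : G.Adj c d)
    (i j : Bool) :
    (EdgePaths G).Adj (Sum.inr (⟨(a, b), h⟩, i)) (Sum.inr (⟨(c, d), h2⟩, j)) ↔
      i = j ∧ a = d ∧ b = c := by
  have := h.ne
  simp only [EdgePaths, SimpleGraph.fromRel_adj]
  grind

/-- Private neighbours in minimal dominating sets. -/
lemma exists_private {V : Type*} {G : SimpleGraph V} {D : Set V} (hD : MinimalDominating G D)
    {x : V} (hx : x ∈ D) :
    ∃ w, (w = x ∨ (w ∉ D ∧ G.Adj x w)) ∧ ∀ y ∈ D, y ≠ x → ¬ G.Adj y w := by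
  have h := hD.2 (D \ {x}) (by
    refine ⟨Set.diff_subset, fun h => ?_⟩
    exact (h hx).2 rfl)
  simp only [Dominating] at h
  push Not at h
  obtain ⟨w, hw, hn⟩ := h
  refine ⟨w, ?_, fun y hy hne => hn y ⟨hy, hne⟩⟩
  by_cases hwx : w = x
  · exact Or.inl hwx
  · have hwD : w ∉ D := fun h => hw ⟨h, hwx⟩
    obtain ⟨u, hu, ha⟩ := hD.1 w hwD
    by_cases hux : u = x
    · subst hux; exact Or.inr ⟨hwD, ha⟩
    · exact absurd ha (hn u ⟨hu, hux⟩)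

/-- In a finite graph every independent set is contained in a minimal dominating set. -/
lemma exists_minDom {V : Type*} [Finite V] {G : SimpleGraph V} {S : Set V} (hS : IndepSet G S) :
    ∃ D, S ⊆ D ∧ MinimalDominating G D := by
  obtain ⟨D, hSD, hD⟩ := (Set.toFinite {T : Set V | IndepSet G T}).exists_le_maximal hS
  refine ⟨D, hSD, ?_, ?_⟩
  · intro v hv
    by_contra hcon
    push Not at hcon
    have hi : IndepSet G (insert v D) := by
      intro a ha b hb hab
      rcases ha with rfl | ha <;> rcases hb with rfl | hb
      · exact hab.ne rfl
      · exact hcon b hb hab.symm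
      · exact hcon a ha hab
      · exact hD.prop a ha b hb hab
    exact hv (hD.le_of_ge hi (Set.subset_insert v D) (Set.mem_insert v D))
  · intro D' hD' hdom
    obtain ⟨x, hx, hx'⟩ := Set.exists_of_ssubset hD'
    obtain ⟨u, hu, ha⟩ := hdom x hx'
    exact hD.prop u (hD'.1 hu) x hx ha

lemma ep_forward {V : Type*} [Fintype V] (G : SimpleGraph V) (S : Set V) (hS : IndepSet G S) :
    ∃ D : Set (GadgetVert G), MinimalDominating (EdgePaths G) D ∧
      S.ncard + 2 * G.edgeSet.ncard ≤ D.ncard := by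
  have hf : ∀ e : G.edgeSet, ∃ p : { p : V × V // G.Adj p.1 p.2 },
      s(p.1.1, p.1.2) = e.1 ∧ p.1.1 ∉ S := by
    rintro ⟨e, he⟩
    induction e using Sym2.ind with
    | _ a b =>
      have hab : G.Adj a b := he
      by_cases ha : a ∈ S
      · exact ⟨⟨(b, a), hab.symm⟩, Sym2.eq_swap, fun hb => hS a ha b hb hab⟩
      · exact ⟨⟨(a, b), hab⟩, rfl, ha⟩
  choose f hf1 hf2 using hf
  let g : S ⊕ (G.edgeSet × Bool) → GadgetVert G :=
    Sum.map Subtype.val (Prod.map f id)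
  have hfi : Function.Injective f := fun e e' h => by
    apply Subtype.ext
    rw [← hf1, ← hf1, h]
  have hg : Function.Injective g :=
    Subtype.val_injective.sumMap (hfi.prodMap Function.injective_id)
  have hind : IndepSet (EdgePaths G) (Set.range g) := by
    rintro _ ⟨x, rfl⟩ _ ⟨y, rfl⟩ hadj
    rcases x with ⟨s, hs⟩ | ⟨e, i⟩ <;> rcases y with ⟨t, ht⟩ | ⟨e', j⟩
    · exact ep_adj_ll G _ _ hadj
    · have := (ep_adj_lr G s (f e').1.1 (f e').1.2 (f e').2 j).1 hadj
      exact hf2 e' (this ▸ hs)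
    · have := (ep_adj_rl G t (f e).1.1 (f e).1.2 (f e).2 i).1 hadj
      exact hf2 e (this ▸ ht)
    · have := (ep_adj_rr G (f e).1.1 (f e).1.2 (f e').1.1 (f e').1.2 (f e).2 (f e').2 i j).1 hadj
      have hee : e = e' := by
        apply Subtype.ext
        rw [← hf1, ← hf1, this.2.1, this.2.2]
        exact Sym2.eq_swap
      subst hee
      exact (f e).2.ne this.2.1
  obtain ⟨D, hsub, hD⟩ := exists_minDom hind
  refine ⟨D, hD, ?_⟩
  have h1 := Set.ncard_le_ncard hsub (Set.toFinite D)
  have h2 : (Set.range g).ncard = S.ncard + 2 * G.edgeSet.ncard := by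
    rw [← Set.image_univ, Set.ncard_image_of_injective _ hg, Set.ncard_univ, Nat.card_sum,
      Nat.card_prod, Nat.card_coe_set_eq, Nat.card_coe_set_eq]
    simp [mul_comm]
  omega

/-- A minimal dominating set contains at most one internal vertex of each path. -/
lemma ep_not_both {V : Type*} (G : SimpleGraph V) (D : Set (GadgetVert G))
    (hD : MinimalDominating (EdgePaths G) D) (a b : V) (h : G.Adj a b) (i : Bool)
    (h1 : (Sum.inr (⟨(a, b), h⟩, i) : GadgetVert G) ∈ D)
    (h2 : (Sum.inr (⟨(b, a), h.symm⟩, i) : GadgetVert G) ∈ D) : False := by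
  have key : ∀ (a b : V) (h : G.Adj a b),
      (Sum.inr (⟨(a, b), h⟩, i) : GadgetVert G) ∈ D →
      (Sum.inr (⟨(b, a), h.symm⟩, i) : GadgetVert G) ∈ D →
      (Sum.inl a : GadgetVert G) ∉ D ∧
        (Sum.inr (⟨(a, b), h⟩, !i) : GadgetVert G) ∉ D := by
    intro a b h h1 h2
    obtain ⟨w, hw, hp⟩ := exists_private hD h1
    have hne := h.ne
    rcases hw with rfl | ⟨hwD, hadj⟩
    · exact absurd ((ep_adj_rr G _ _ _ _ _ _ _ _).2 ⟨rfl, rfl, rfl⟩)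
        (hp _ h2 (by simp [hne.symm]))
    · rcases w with w | ⟨⟨⟨c, d⟩, hcd⟩, j⟩
      · rw [ep_adj_rl] at hadj
        subst hadj
        refine ⟨hwD, fun hx => hp _ hx (by simp) ?_⟩
        rw [ep_adj_rl]
      · rw [ep_adj_rr] at hadj
        obtain ⟨rfl, rfl, rfl⟩ := hadj
        exact absurd h2 hwD
  obtain ⟨ka, ka'⟩ := key a b h h1 h2
  obtain ⟨kb, kb'⟩ := key b a h.symm h2 h1
  obtain ⟨u, hu, hadj⟩ := hD.1 _ ka'
  rcases u with w | ⟨⟨⟨c, d⟩, hcd⟩, j⟩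
  · rw [ep_adj_lr] at hadj
    subst hadj
    exact ka hu
  · rw [ep_adj_rr] at hadj
    obtain ⟨rfl, rfl, rfl⟩ := hadj
    exact kb' hu

/-- If both ends of an edge are in a minimal dominating set, no internal vertex is. -/
lemma ep_none {V : Type*} (G : SimpleGraph V) (D : Set (GadgetVert G))
    (hD : MinimalDominating (EdgePaths G) D) (a b : V) (h : G.Adj a b) (i : Bool)
    (h1 : (Sum.inr (⟨(a, b), h⟩, i) : GadgetVert G) ∈ D)
    (ha : (Sum.inl a : GadgetVert G) ∈ D) (hb : (Sum.inl b : GadgetVert G) ∈ D) : False := by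
  obtain ⟨w, hw, hp⟩ := exists_private hD h1
  rcases hw with rfl | ⟨hwD, hadj⟩
  · exact hp _ ha (by simp) ((ep_adj_lr G _ _ _ _ _).2 rfl)
  · rcases w with w | ⟨⟨⟨c, d⟩, hcd⟩, j⟩
    · rw [ep_adj_rl] at hadj
      subst hadj
      exact hwD ha
    · rw [ep_adj_rr] at hadj
      obtain ⟨rfl, rfl, rfl⟩ := hadj
      exact hp _ hb (by simp) ((ep_adj_lr G _ _ _ _ _).2 rfl)

lemma ep_backward {V : Type*} [Fintype V] (G : SimpleGraph V) (D : Set (GadgetVert G))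
    (hD : MinimalDominating (EdgePaths G) D) :
    ∃ S : Set V, IndepSet G S ∧ D.ncard ≤ S.ncard + 2 * G.edgeSet.ncard := by
  let A : Set V := Sum.inl ⁻¹' D
  let B : Set ({ p : V × V // G.Adj p.1 p.2 } × Bool) := Sum.inr ⁻¹' D
  let E : Set (Sym2 V) := {e | e ∈ G.edgeSet ∧ ∀ v ∈ e, v ∈ A}
  have hE : E ⊆ G.edgeSet := fun e he => he.1
  have hDc : D.ncard ≤ A.ncard + B.ncard := by
    have : D = Sum.inl '' A ∪ Sum.inr '' B := by
      ext x
      rcases x with x | x <;> simp [A, B]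
    calc D.ncard = (Sum.inl '' A ∪ Sum.inr '' B : Set (GadgetVert G)).ncard := by rw [← this]
      _ ≤ _ := Set.ncard_union_le _ _
      _ = _ := by
        rw [Set.ncard_image_of_injective _ Sum.inl_injective,
          Set.ncard_image_of_injective _ Sum.inr_injective]
  have hB : B.ncard ≤ (G.edgeSet \ E).ncard * 2 := by
    have : ((G.edgeSet \ E) ×ˢ (Set.univ : Set Bool)).ncard = (G.edgeSet \ E).ncard * 2 := by
      rw [Set.ncard_prod, Set.ncard_univ]; simp
    rw [← this]
    refine Set.ncard_le_ncard_of_injOn (fun x => (s(x.1.1.1, x.1.1.2), x.2)) ?_ ?_ (Set.toFinite _)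
    · rintro ⟨⟨⟨a, b⟩, h⟩, i⟩ hx
      refine ⟨⟨h, fun he => ?_⟩, trivial⟩
      exact ep_none G D hD a b h i hx (he.2 a (by simp)) (he.2 b (by simp))
    · rintro ⟨⟨⟨a, b⟩, h⟩, i⟩ hx ⟨⟨⟨c, d⟩, h'⟩, j⟩ hy hxy
      simp only [Prod.mk.injEq, Sym2.eq_iff] at hxy
      obtain ⟨⟨rfl, rfl⟩ | ⟨rfl, rfl⟩, rfl⟩ := hxy
      · rfl
      · exact (ep_not_both G D hD _ _ h i hx hy).elim
  let f : Sym2 V → V := fun e => (Quot.out e).1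
  have hfm : ∀ e, f e ∈ e := fun e => Sym2.out_fst_mem e
  have h1 : (G.edgeSet \ E).ncard + E.ncard = G.edgeSet.ncard :=
    Set.ncard_diff_add_ncard_of_subset hE (Set.toFinite _)
  have h2 : (f '' E).ncard ≤ E.ncard := Set.ncard_image_le (Set.toFinite _)
  have h3 : A.ncard ≤ (A \ f '' E).ncard + (f '' E).ncard :=
    Set.ncard_le_ncard_diff_add_ncard _ _ (Set.toFinite _)
  refine ⟨A \ f '' E, ?_, by omega⟩
  rintro u ⟨hu, hu'⟩ v ⟨hv, hv'⟩ huv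
  have he : s(u, v) ∈ E := ⟨huv, by simp [hu, hv]⟩
  rcases Sym2.mem_iff.1 (hfm s(u, v)) with h | h
  · exact hu' ⟨_, he, h⟩
  · exact hv' ⟨_, he, h⟩

/-- `G` has an independent set of size at least `k` iff the graph `G'` obtained by replacing
each of the `m` edges of `G` by two paths has a minimal dominating set of size at least
`k + 2m`. -/
theorem indep_iff_minimalDominating_edgePaths {V : Type*} [Fintype V] (G : SimpleGraph V)
    (k : ℕ) :
    (∃ S : Set V, IndepSet G S ∧ k ≤ S.ncard) ↔
    (∃ D : Set (GadgetVert G), MinimalDominating (EdgePaths G) D ∧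
      k + 2 * G.edgeSet.ncard ≤ D.ncard) := by
  constructor
  · rintro ⟨S, hS, hk⟩
    obtain ⟨D, hD, h⟩ := ep_forward G S hS
    exact ⟨D, hD, by omega⟩
  · rintro ⟨D, hD, hk⟩
    obtain ⟨S, hS, h⟩ := ep_backward G D hD
    exact ⟨S, hS, by omega⟩
end

section
/- Let G = (V,E) be a finite simple graph and let G' be the graph obtained from G by replacing each edge by two paths as described. Then for every minimal dominating set D of G' and every edge e = uv ∈ E, the set D ∩ {u_e, v_e, u'_e, v'_e} has cardinality 0 or 2; moreover, if it has cardinality 2, then D contains exactly one vertex of {u_e, v_e} and exactly one vertex of {u'_e, v'_e}, and D contains at most one of the vertices u and v. -/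
theorem private_nbr {V : Type*} (G : SimpleGraph V) (D : Set V) (hD : MinimalDominating G D)
    (x : V) (hx : x ∈ D) :
    ∃ y, (y = x ∨ G.Adj y x) ∧ ∀ z ∈ D, (z = y ∨ G.Adj z y) → z = x := by
  have h1 := hD.2 (D \ {x}) ⟨Set.diff_subset, fun hh => (hh hx).2 rfl⟩
  unfold Dominating at h1
  push Not at h1
  obtain ⟨y, hy, hz⟩ := h1
  have key : ∀ z ∈ D, (z = y ∨ G.Adj z y) → z = x := by
    intro z hzD hzy
    by_contra hne
    rcases hzy with rfl | hadj
    · exact hy ⟨hzD, hne⟩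
    · exact hz z ⟨hzD, hne⟩ hadj
  refine ⟨y, ?_, key⟩
  by_cases hyD : y ∈ D
  · exact Or.inl (key y hyD (Or.inl rfl))
  · obtain ⟨z, hzD, hzy⟩ := hD.1 y hyD
    have := key z hzD (Or.inr hzy)
    subst this
    exact Or.inr hzy.symm

theorem edgePaths_adj_inr {V : Type*} (G : SimpleGraph V) (u v : V) (h : G.Adj u v) (i : Bool)
    (y : GadgetVert G) :
    (EdgePaths G).Adj y (Sum.inr ⟨⟨(u, v), h⟩, i⟩) ↔
      y = Sum.inl u ∨ y = Sum.inr ⟨⟨(v, u), h.symm⟩, i⟩ := by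
  have := h.ne
  rcases y with w | ⟨⟨⟨a, b⟩, hab⟩, j⟩
  · simp [EdgePaths]
  · simp only [EdgePaths, SimpleGraph.fromRel_adj]
    simp
    grind

theorem gadget_facts {V : Type*} (G : SimpleGraph V)
    (D : Set (GadgetVert G)) (hD : MinimalDominating (EdgePaths G) D)
    (u v : V) (h : G.Adj u v) (i j : Bool) (hij : i ≠ j)
    (a b a' : GadgetVert G)
    (ha : a = Sum.inr ⟨⟨(u, v), h⟩, i⟩)
    (hb : b = Sum.inr ⟨⟨(v, u), h.symm⟩, i⟩)
    (ha' : a' = Sum.inr ⟨⟨(u, v), h⟩, j⟩) :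
    (a ∈ D ∨ b ∈ D ∨ Sum.inl u ∈ D) ∧
    (a ∈ D → (Sum.inl u ∉ D ∧ b ∉ D) ∨ (Sum.inl u ∉ D ∧ a' ∉ D) ∨
      (b ∉ D ∧ Sum.inl v ∉ D)) := by
  have hne := h.ne
  have hua : (EdgePaths G).Adj (Sum.inl u) a := by
    subst ha; rw [edgePaths_adj_inr]; simp
  have hua' : (EdgePaths G).Adj (Sum.inl u) a' := by
    subst ha'; rw [edgePaths_adj_inr]; simp
  have hvb : (EdgePaths G).Adj (Sum.inl v) b := by
    subst hb; rw [edgePaths_adj_inr]; simp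
  have hba : (EdgePaths G).Adj b a := by
    subst ha hb; rw [edgePaths_adj_inr]; simp
  have hN : ∀ y, (EdgePaths G).Adj y a → y = Sum.inl u ∨ y = b := by
    intro y; subst ha hb; rw [edgePaths_adj_inr]; exact id
  have n1 : a ≠ a' := by subst ha ha'; simp [hij]
  have n2 : a ≠ Sum.inl u := hua.ne'
  have n3 : a ≠ Sum.inl v := by subst ha; simp
  have n4 : a ≠ b := hba.ne'
  constructor
  · by_contra hc
    push Not at hc
    obtain ⟨z, hz, hza⟩ := hD.1 a hc.1
    rcases hN z hza with rfl | rfl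
    · exact hc.2.2 hz
    · exact hc.2.1 hz
  · intro haD
    obtain ⟨y, hy, key⟩ := private_nbr _ D hD a haD
    have hk : y = a ∨ y = Sum.inl u ∨ y = b := hy.imp id (hN y)
    rcases hk with rfl | rfl | rfl
    · exact Or.inl ⟨fun hh => n2 (key _ hh (Or.inr hua)).symm,
        fun hh => n4 (key _ hh (Or.inr hba)).symm⟩
    · exact Or.inr (Or.inl ⟨fun hh => n2 (key _ hh (Or.inl rfl)).symm,
        fun hh => n1 (key _ hh (Or.inr hua'.symm)).symm⟩)
    · exact Or.inr (Or.inr ⟨fun hh => n4 (key _ hh (Or.inl rfl)).symm,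
        fun hh => n3 (key _ hh (Or.inr hvb)).symm⟩)

/-- For every minimal dominating set `D` of `G'` and every edge `e = uv` of `G`, the set
`D ∩ {u_e, v_e, u'_e, v'_e}` has cardinality `0` or `2`; if it has cardinality `2`, then `D`
contains exactly one vertex of `{u_e, v_e}`, exactly one vertex of `{u'_e, v'_e}`, and at
most one of `u` and `v`. -/
theorem minimalDominating_gadget_trace {V : Type*} [Fintype V] (G : SimpleGraph V)
    (D : Set (GadgetVert G)) (hD : MinimalDominating (EdgePaths G) D)
    (u v : V) (h : G.Adj u v)
    (ve ue ve' ue' : GadgetVert G)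
    (hve : ve = Sum.inr ⟨⟨(u, v), h⟩, false⟩)
    (hue : ue = Sum.inr ⟨⟨(v, u), h.symm⟩, false⟩)
    (hve' : ve' = Sum.inr ⟨⟨(u, v), h⟩, true⟩)
    (hue' : ue' = Sum.inr ⟨⟨(v, u), h.symm⟩, true⟩) :
    ((D ∩ {ue, ve, ue', ve'}).ncard = 0 ∨ (D ∩ {ue, ve, ue', ve'}).ncard = 2) ∧
    ((D ∩ {ue, ve, ue', ve'}).ncard = 2 →
      (D ∩ {ue, ve}).ncard = 1 ∧ (D ∩ {ue', ve'}).ncard = 1 ∧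
      (D ∩ ({Sum.inl u, Sum.inl v} : Set (GadgetVert G))).ncard ≤ 1) := by
  have hne := h.ne
  have f1 := gadget_facts G D hD u v h false true (by simp) ve ue ve' hve hue hve'
  have f2 := gadget_facts G D hD v u h.symm false true (by simp) ue ve ue' hue hve hue'
  have f3 := gadget_facts G D hD u v h true false (by simp) ve' ue' ve hve' hue' hve
  have f4 := gadget_facts G D hD v u h.symm true false (by simp) ue' ve' ue hue' hve' hue
  have n1 : ue ≠ ve := by subst hue hve; simp [hne]
  have n2 : ue ≠ ue' := by subst hue hue'; simp
  have n3 : ue ≠ ve' := by subst hue hve'; simp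
  have n4 : ve ≠ ue' := by subst hve hue'; simp
  have n5 : ve ≠ ve' := by subst hve hve'; simp
  have n6 : ue' ≠ ve' := by subst hue' hve'; simp [hne]
  clear hve hue hve' hue'
  by_cases a1 : ue ∈ D <;> by_cases a2 : ve ∈ D <;> by_cases a3 : ue' ∈ D <;>
    by_cases a4 : ve' ∈ D <;> by_cases a5 : Sum.inl u ∈ D <;> by_cases a6 : Sum.inl v ∈ D <;>
    simp only [a1, a2, a3, a4, a5, a6, not_true_eq_false, not_false_eq_true, true_and, and_true,
      false_and, and_false, or_true, true_or, or_false, false_or, forall_const, imp_false,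
      and_self, or_self, false_imp_iff] at f1 f2 f3 f4 <;>
    simp [Set.inter_insert_of_mem, Set.inter_insert_of_notMem, Set.ncard_pair,
      a1, a2, a3, a4, a5, a6, n1, n2, n3, n4, n5, n6]
end

section
/- Let G be a finite simple graph with vertex set V and at least one edge, and let D' be a minimal dominating set of Q(G) with |D'| ≥ 3. Then either D' is entirely contained in the set V of old vertices or D' is entirely contained in the set E of new vertices. -/
/-- The graph `Q(G)` on the old vertices (vertices of `G`) and the new vertices (edges of
`G`): the old vertices form a clique, the new vertices form a clique, and an old vertex `v`
is adjacent to a new vertex `e` iff `v` is an endpoint of `e` in `G`. -/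
def Qgraph {V : Type*} (G : SimpleGraph V) : SimpleGraph (V ⊕ G.edgeSet) :=
  SimpleGraph.fromRel (fun x y =>
    match x, y with
    | Sum.inl _, Sum.inl _ => True
    | Sum.inr _, Sum.inr _ => True
    | Sum.inl v, Sum.inr e => v ∈ (e : Sym2 V)
    | Sum.inr _, Sum.inl _ => False)

/-- If `G` has at least one edge and `D'` is a minimal dominating set of `Q(G)` with
`|D'| ≥ 3`, then `D'` consists entirely of old vertices or entirely of new vertices. -/
theorem minimalDominating_Qgraph_old_or_new {V : Type*} [Fintype V] (G : SimpleGraph V)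
    (he : G.edgeSet.Nonempty)
    (D : Set (V ⊕ G.edgeSet)) (hD : MinimalDominating (Qgraph G) D)
    (h3 : 3 ≤ D.ncard) :
    (∀ x ∈ D, ∃ v : V, x = Sum.inl v) ∨ (∀ x ∈ D, ∃ e : G.edgeSet, x = Sum.inr e) := by
  by_contra hcon
  push Not at hcon
  obtain ⟨⟨x, hx, hx'⟩, y, hy, hy'⟩ := hcon
  obtain ⟨v, rfl⟩ : ∃ v, y = Sum.inl v := by
    rcases y with v | e
    · exact ⟨v, rfl⟩
    · exact absurd rfl (hy' e)
  obtain ⟨e, rfl⟩ : ∃ e, x = Sum.inr e := by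
    rcases x with v | e
    · exact absurd rfl (hx' v)
    · exact ⟨e, rfl⟩
  refine hD.2 {Sum.inl v, Sum.inr e} ?_ ?_
  · refine (Set.ssubset_iff_subset_ne).2 ⟨?_, ?_⟩
    · rintro z (rfl | rfl) <;> assumption
    · intro h
      have h2 := Set.ncard_insert_le (Sum.inl v : V ⊕ G.edgeSet) {Sum.inr e}
      rw [h, Set.ncard_singleton] at h2
      omega
  · intro z hz
    rcases z with w | f
    · refine ⟨Sum.inl v, by simp, ?_⟩
      have : Sum.inl v ≠ (Sum.inl w : V ⊕ G.edgeSet) := by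
        intro h
        exact hz (by simp [h])
      exact ⟨this, Or.inl trivial⟩
    · refine ⟨Sum.inr e, by simp, ?_⟩
      have : Sum.inr e ≠ (Sum.inr f : V ⊕ G.edgeSet) := by
        intro h
        exact hz (by simp [h])
      exact ⟨this, Or.inl trivial⟩
end

section
/- Let G be a finite simple graph with n vertices and let D be a dominating set of G with D ≠ V such that every vertex of D has a private neighbour outside of D. For each vertex u ∉ D, choose an edge e_u of G joining u to a vertex of D. Then the set D' = { v_{e_u} : u ∉ D } of new vertices is a minimal dominating set of Q(G) of cardinality n − |D|. -/
/-- Let `D ≠ V` be a dominating set of `G` such that every vertex of `D` has a private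
neighbour outside `D`, and for each vertex `u ∉ D` let `f u = e_u` be an edge joining `u`
to a vertex of `D`. Then `D' = {v_{e_u} : u ∉ D}` is a minimal dominating set of `Q(G)` of
cardinality `n - |D|`. -/
theorem chosen_edges_minimalDominating_Qgraph {V : Type*} [Fintype V] (G : SimpleGraph V)
    (D : Set V) (hdom : Dominating G D) (hne : D ≠ Set.univ)
    (hpriv : ∀ x ∈ D, ∃ y : V, PrivateNbr G D x y)
    (f : V → Sym2 V)
    (hf : ∀ u ∉ D, ∃ w ∈ D, G.Adj u w ∧ f u = s(u, w))
    (D' : Set (V ⊕ G.edgeSet))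
    (hD' : D' = {x | ∃ u, u ∉ D ∧ ∃ h : f u ∈ G.edgeSet, x = Sum.inr ⟨f u, h⟩}) :
    MinimalDominating (Qgraph G) D' ∧ D'.ncard = Fintype.card V - D.ncard := by
  have hinr : ∀ (v : V) (e : G.edgeSet),
      (Qgraph G).Adj (Sum.inr e) (Sum.inl v) ↔ v ∈ (e : Sym2 V) := by
    intro v e
    simp [Qgraph, SimpleGraph.fromRel_adj]
  have hee : ∀ (e e' : G.edgeSet), e ≠ e' →
      (Qgraph G).Adj (Sum.inr e) (Sum.inr e') := by
    intro e e' h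
    simp [Qgraph, SimpleGraph.fromRel_adj, h]
  have hmem : ∀ u ∉ D, f u ∈ G.edgeSet := by
    intro u hu
    obtain ⟨w, _, ha, he⟩ := hf u hu
    rw [he]
    exact ha
  have huniq : ∀ u ∉ D, ∀ u' ∉ D, u ∈ f u' → u = u' := by
    intro u hu u' hu' h
    obtain ⟨w, hw, _, he⟩ := hf u' hu'
    rw [he, Sym2.mem_iff] at h
    rcases h with h | h
    · exact h
    · exact absurd (h ▸ hw) hu
  have hself : ∀ u ∉ D, u ∈ f u := by
    intro u hu
    obtain ⟨w, _, _, he⟩ := hf u hu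
    rw [he]
    exact Sym2.mem_mk_left u w
  have hin : ∀ u (hu : u ∉ D), (Sum.inr ⟨f u, hmem u hu⟩ : V ⊕ G.edgeSet) ∈ D' := by
    intro u hu
    rw [hD']
    exact ⟨u, hu, hmem u hu, rfl⟩
  refine ⟨⟨?_, ?_⟩, ?_⟩
  · rintro (v | e) hv
    · by_cases hvD : v ∈ D
      · obtain ⟨y, _, hy, _, hz⟩ := hpriv v hvD
        refine ⟨_, hin y hy, (hinr _ _).2 ?_⟩
        obtain ⟨w, hw, ha, he⟩ := hf y hy
        have hwv := hz w hw ha.symm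
        subst hwv
        change w ∈ f y
        rw [he]
        exact Sym2.mem_mk_right y w
      · exact ⟨_, hin v hvD, (hinr _ _).2 (hself v hvD)⟩
    · obtain ⟨u, hu⟩ := (Set.ne_univ_iff_exists_notMem D).1 hne
      refine ⟨_, hin u hu, hee _ _ ?_⟩
      intro h
      exact hv (h ▸ hin u hu)
  · intro D'' hss hd
    obtain ⟨hsub, x, hx, hx'⟩ := Set.ssubset_iff_exists.1 hss
    rw [hD'] at hx
    obtain ⟨u, hu, h, rfl⟩ := hx
    have hnot : (Sum.inl u : V ⊕ G.edgeSet) ∉ D'' := by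
      intro hc
      have := hsub hc
      rw [hD'] at this
      obtain ⟨_, _, _, h⟩ := this
      cases h
    obtain ⟨z, hz, ha⟩ := hd _ hnot
    have hz' := hsub hz
    rw [hD'] at hz'
    obtain ⟨u', hu', h', rfl⟩ := hz'
    have := huniq u hu u' hu' ((hinr _ _).1 ha)
    subst this
    exact hx' hz
  · rw [← Nat.card_eq_fintype_card, ← Set.ncard_compl]
    symm
    refine Set.ncard_congr (fun u hu => Sum.inr ⟨f u, hmem u hu⟩) (fun u hu => hin u hu) ?_ ?_
    · intro a b ha hb h
      have h1 : f a = f b := by simpa using h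
      exact huniq a ha b hb (h1 ▸ hself a ha)
    · intro x hx
      rw [hD'] at hx
      obtain ⟨u, hu, h, rfl⟩ := hx
      exact ⟨u, hu, rfl⟩
end

section
/- Let G be a finite simple graph with vertex set V and at least one edge, and let D' be a minimal dominating set of Q(G) that is entirely contained in the set V of old vertices. Then V − D' is a maximal independent set of G. -/
/-- A maximal independent set is an independent set not properly contained in another one. -/
def MaximalIndep {V : Type*} (G : SimpleGraph V) (S : Set V) : Prop :=
  IndepSet G S ∧ ∀ S', S ⊂ S' → ¬ IndepSet G S'

/-- If `G` has at least one edge and `D'` is a minimal dominating set of `Q(G)` consisting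
entirely of old vertices, then `V - D'` is a maximal independent set of `G`. -/
theorem compl_minimalDominating_Qgraph_maximalIndep {V : Type*} [Fintype V]
    (G : SimpleGraph V) (he : G.edgeSet.Nonempty)
    (D : Set (V ⊕ G.edgeSet)) (hD : MinimalDominating (Qgraph G) D)
    (hold : ∀ x ∈ D, ∃ v : V, x = Sum.inl v) :
    MaximalIndep G {v : V | Sum.inl v ∉ D} := by
  obtain ⟨hdom, hmin⟩ := hD
  refine ⟨?_, ?_⟩
  · intro a ha b hb hab
    have hn : (Sum.inr ⟨s(a, b), hab⟩ : V ⊕ G.edgeSet) ∉ D := by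
      intro h
      obtain ⟨v, hv⟩ := hold _ h
      cases hv
    obtain ⟨u, hu, hadj⟩ := hdom _ hn
    obtain ⟨v, rfl⟩ := hold _ hu
    have hv : v = a ∨ v = b := by
      simpa [Qgraph, SimpleGraph.fromRel_adj] using hadj
    rcases hv with rfl | rfl
    · exact ha hu
    · exact hb hu
  · intro S' hS hind
    obtain ⟨hsub, hns⟩ := hS
    obtain ⟨w, hwS, hw⟩ := Set.not_subset.mp hns
    have hwD : Sum.inl w ∈ D := by
      by_contra h
      exact hw h
    have key : ∀ e : G.edgeSet, ∃ v : V, v ∈ (e : Sym2 V) ∧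
        (Sum.inl v : V ⊕ G.edgeSet) ∈ D \ {Sum.inl w} := by
      rintro ⟨e, hee⟩
      induction e with
      | h a b =>
        have aux : ∀ c, c ∉ S' → (Sum.inl c : V ⊕ G.edgeSet) ∈ D \ {Sum.inl w} := by
          intro c hc
          refine ⟨?_, ?_⟩
          · by_contra h
            exact hc (hsub h)
          · intro h
            have h2 : c = w := Sum.inl.inj h
            exact hc (h2 ▸ hwS)
        by_cases ha : a ∈ S'
        · exact ⟨b, by simp, aux b (fun hb => hind a ha b hb hee)⟩
        · exact ⟨a, by simp, aux a ha⟩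
    refine hmin (D \ {Sum.inl w}) ⟨Set.diff_subset, fun h => (h hwD).2 rfl⟩ ?_
    rintro (x | e) hx
    · obtain ⟨e, he⟩ := he
      obtain ⟨v, -, hv⟩ := key ⟨e, he⟩
      refine ⟨_, hv, ?_⟩
      have hne : v ≠ x := by
        rintro rfl
        exact hx hv
      simpa [Qgraph, SimpleGraph.fromRel_adj] using hne
    · obtain ⟨v, hve, hv⟩ := key e
      exact ⟨_, hv, by simpa [Qgraph, SimpleGraph.fromRel_adj] using hve⟩
end

section
/- Let G be a finite simple graph with n vertices and let D' be a minimal dominating set of Q(G) with |D'| ≥ 3 that is entirely contained in the set E of new vertices. Then the set F = { e ∈ E : v_e ∈ D' } of edges of G covers every vertex of G, the spanning subgraph (V, F) of G contains no cycle, and every connected component of (V, F) with at least one edge is a star (equivalently, (V,F) contains no path on 4 vertices); consequently, the set of centers of these stars is a dominating set of G of cardinality n − |D'|. -/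
/-- Let `D'` be a minimal dominating set of `Q(G)` with `|D'| ≥ 3` consisting entirely of
new vertices, and let `F` be the corresponding set of edges of `G`. Then `F` covers every
vertex of `G`; the spanning subgraph `(V, F)` is acyclic and contains no path on four
vertices (so each of its components with an edge is a star); consequently, the set of
centers of these stars is a dominating set of `G` of cardinality `n - |D'|` (each center
belongs to some edge of `F`, and every edge of `F` through a neighbour of a center also
passes through that center). -/
theorem minimalDominating_Qgraph_new_star_forest {V : Type*} [Fintype V] (G : SimpleGraph V)
    (D : Set (V ⊕ G.edgeSet)) (hD : MinimalDominating (Qgraph G) D)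
    (h3 : 3 ≤ D.ncard)
    (hnew : ∀ x ∈ D, ∃ e : G.edgeSet, x = Sum.inr e)
    (F : Set (Sym2 V))
    (hF : F = {e : Sym2 V | ∃ h : e ∈ G.edgeSet, Sum.inr ⟨e, h⟩ ∈ D}) :
    (∀ v : V, ∃ e ∈ F, v ∈ e) ∧
    (SimpleGraph.fromEdgeSet F).IsAcyclic ∧
    (∀ a b c d : V, (SimpleGraph.fromEdgeSet F).Adj a b →
      (SimpleGraph.fromEdgeSet F).Adj b c → (SimpleGraph.fromEdgeSet F).Adj c d →
      a = c ∨ b = d ∨ a = d) ∧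
    (∃ C : Set V, Dominating G C ∧ C.ncard = Fintype.card V - D.ncard ∧
      ∀ v ∈ C, (∃ e ∈ F, v ∈ e) ∧
        ∀ w : V, (SimpleGraph.fromEdgeSet F).Adj v w → ∀ e ∈ F, w ∈ e → v ∈ e) := by
  classical
  have hFG : ∀ e ∈ F, e ∈ G.edgeSet := by
    intro e he
    rw [hF] at he
    exact he.1
  have hFD : ∀ e (he : e ∈ F), (Sum.inr ⟨e, hFG e he⟩ : V ⊕ G.edgeSet) ∈ D := by
    intro e he
    have h := he
    rw [hF] at h
    exact h.2
  have hDF : ∀ e : G.edgeSet, (Sum.inr e : V ⊕ G.edgeSet) ∈ D → (e : Sym2 V) ∈ F := by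
    intro e he
    rw [hF]
    exact ⟨e.2, he⟩
  have hcard : F.ncard = D.ncard := by
    refine Set.ncard_congr (fun e he => Sum.inr ⟨e, hFG e he⟩) hFD ?_ ?_
    · intro a b ha hb h
      simpa using h
    · intro x hx
      obtain ⟨e, rfl⟩ := hnew x hx
      exact ⟨e, hDF e hx, rfl⟩
  have hcov : ∀ v : V, ∃ e ∈ F, v ∈ e := by
    intro v
    have hv : (Sum.inl v : V ⊕ G.edgeSet) ∉ D := by
      intro h
      obtain ⟨e, he⟩ := hnew _ h
      cases he
    obtain ⟨u, hu, huv⟩ := hD.1 _ hv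
    obtain ⟨e, rfl⟩ := hnew u hu
    refine ⟨e, hDF e hu, ?_⟩
    simpa [Qgraph] using huv
  have hpriv : ∀ e ∈ F, ∃ v ∈ e, ∀ e' ∈ F, v ∈ e' → e' = e := by
    intro e he
    have hx := hFD e he
    have hnd := hD.2 (D \ {Sum.inr ⟨e, hFG e he⟩}) (by
      refine ⟨Set.sdiff_subset, fun h => ?_⟩
      exact (h hx).2 rfl)
    unfold Dominating at hnd
    push Not at hnd
    obtain ⟨x, hxD, hxn⟩ := hnd
    rcases x with v | f
    · have key : ∀ e' ∈ F, v ∈ e' → e' = e := by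
        intro e' he' hv
        by_contra hne
        refine hxn (Sum.inr ⟨e', hFG e' he'⟩) ⟨hFD e' he', ?_⟩ ?_
        · simpa using hne
        · simpa [Qgraph] using hv
      obtain ⟨e', he', hv⟩ := hcov v
      have := key e' he' hv
      subst this
      exact ⟨v, hv, key⟩
    · exfalso
      have h2 : 1 < D.ncard := by omega
      obtain ⟨y, hy, hne⟩ := Set.exists_ne_of_one_lt_ncard h2 (Sum.inr ⟨e, hFG e he⟩)
      have hyx : y ∈ D \ {Sum.inr ⟨e, hFG e he⟩} := ⟨hy, hne⟩
      obtain ⟨g, rfl⟩ := hnew y hy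
      have hgf : g ≠ f := by
        rintro rfl
        exact hxD hyx
      exact hxn _ hyx (by simpa [Qgraph] using hgf)
  have hFne : F.Nonempty := Set.nonempty_of_ncard_ne_zero (by omega)
  have hVne : Nonempty V := ⟨hFne.some.out.1⟩
  choose! p hp hpu using hpriv
  have hinj : Set.InjOn p F := by
    intro a ha b hb h
    exact hpu b hb a ha (h ▸ hp a ha)
  refine ⟨hcov, ?_, ?_, ?_⟩
  · rw [SimpleGraph.isAcyclic_iff_forall_adj_isBridge]
    have main : ∀ u v, (SimpleGraph.fromEdgeSet F).Adj u v → p s(u, v) = v →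
        (SimpleGraph.fromEdgeSet F).IsBridge s(u, v) := by
      intro u v huv hpv
      rw [SimpleGraph.isBridge_iff]
      rintro ⟨w⟩
      have w' := w.reverse
      have hF' := (SimpleGraph.fromEdgeSet_adj F).1 huv
      cases w' with
      | nil => exact hF'.2 rfl
      | cons h _ =>
        simp only [SimpleGraph.deleteEdges_adj,
          SimpleGraph.fromEdgeSet_adj, Set.mem_singleton_iff] at h
        have := hpu _ hF'.1 _ h.1.1 (by rw [hpv]; simp)
        exact h.2 this
    intro u v huv
    have hF' := (SimpleGraph.fromEdgeSet_adj F).1 huv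
    rcases Sym2.mem_iff.1 (hp _ hF'.1) with h | h
    · rw [Sym2.eq_swap]
      exact main v u huv.symm (by rw [Sym2.eq_swap]; exact h)
    · exact main u v huv h
  · intro a b c d hab hbc hcd
    rw [SimpleGraph.fromEdgeSet_adj] at hab hbc hcd
    rcases Sym2.mem_iff.1 (hp _ hbc.1) with h | h
    · have := hpu _ hbc.1 _ hab.1 (by rw [h]; simp)
      left
      rw [Sym2.eq_swap] at this
      exact Sym2.congr_right.1 this
    · have := hpu _ hbc.1 _ hcd.1 (by rw [h]; simp)
      right; left
      rw [Sym2.eq_swap] at this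
      exact (Sym2.congr_left.1 this).symm
  · refine ⟨(p '' F)ᶜ, ?_, ?_, ?_⟩
    · intro v hv
      rw [Set.notMem_compl_iff] at hv
      obtain ⟨e, he, rfl⟩ := hv
      obtain ⟨w, hw⟩ := hp e he
      have hadj : G.Adj (p e) w := by
        rw [← SimpleGraph.mem_edgeSet, ← hw]
        exact hFG e he
      refine ⟨w, ?_, hadj.symm⟩
      rintro ⟨e', he', hpe⟩
      have := hpu e' he' e he (by rw [hpe, hw]; simp)
      subst this
      exact hadj.ne hpe
    · rw [Set.ncard_compl, hinj.ncard_image, hcard, Nat.card_eq_fintype_card]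
    · intro v hv
      refine ⟨hcov v, ?_⟩
      intro w hvw e he hwe
      rw [SimpleGraph.fromEdgeSet_adj] at hvw
      rcases Sym2.mem_iff.1 (hp _ hvw.1) with h | h
      · exact absurd ⟨_, hvw.1, h⟩ hv
      · rw [hpu _ hvw.1 e he (by rw [h]; exact hwe)]
        simp
end

section
/- Let G be a 2K2-free finite simple graph, let ab be an edge of G, and let X be a minimal dominating set of G containing both a and b. With N, A, Y, Z defined as in the context, Z ∩ X = ∅ and A − Z ⊆ X. -/
/-- `α(G)`: the maximum cardinality of an independent set of `G`. -/
noncomputable def indepNum {V : Type*} (G : SimpleGraph V) : ℕ :=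
  sSup {n | ∃ S : Set V, IndepSet G S ∧ S.ncard = n}

/-- `G` is `2K₂`-free: it contains no induced subgraph isomorphic to the disjoint union of
two edges, i.e. any two edges on four distinct vertices are joined by some cross edge. -/
def TwoK2Free {V : Type*} (G : SimpleGraph V) : Prop :=
  ∀ a b c d : V, G.Adj a b → G.Adj c d → a ≠ c → a ≠ d → b ≠ c → b ≠ d →
    G.Adj a c ∨ G.Adj a d ∨ G.Adj b c ∨ G.Adj b d

/-- In a `2K₂`-free graph with an edge `ab` and a minimal dominating set `X` containing `a`
and `b`, with `N, A, Y, Z` as in the paper, `Z ∩ X = ∅` and `A - Z ⊆ X`. -/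
theorem twoK2Free_claim2 {V : Type*} [Fintype V] (G : SimpleGraph V) (h2 : TwoK2Free G)
    (a b : V) (hab : G.Adj a b)
    (X : Set V) (hX : MinimalDominating G X) (ha : a ∈ X) (hb : b ∈ X)
    (N A Y Z : Set V)
    (hN : N = {v : V | v ≠ a ∧ v ≠ b ∧ (G.Adj a v ∨ G.Adj b v)})
    (hA : A = {v : V | ¬ G.Adj a v ∧ ¬ G.Adj b v})
    (hY : Y = X ∩ N)
    (hZ : Z = {v ∈ A | ∃ y ∈ Y, G.Adj y v}) :
    Z ∩ X = ∅ ∧ A \ Z ⊆ X := by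
  subst hN hA hY hZ
  -- the set `A` is independent
  have indep : ∀ u v, ¬ G.Adj a u → ¬ G.Adj b u → ¬ G.Adj a v → ¬ G.Adj b v → ¬ G.Adj u v := by
    intro u v hau hbu hav hbv huv
    have h := h2 a b u v hab huv (fun h => hbu (h ▸ hab.symm)) (fun h => hbv (h ▸ hab.symm))
      (fun h => hau (h ▸ hab)) (fun h => hav (h ▸ hab))
    tauto
  obtain ⟨hdom, hmin⟩ := hX
  constructor
  · rw [Set.eq_empty_iff_forall_notMem]
    rintro v ⟨⟨⟨hav, hbv⟩, y, ⟨hyX, -⟩, hyv⟩, hvX⟩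
    refine hmin (X \ {v}) (Set.diff_singleton_ssubset.2 hvX) ?_
    intro w hw
    by_cases hwv : w = v
    · subst hwv
      exact ⟨y, ⟨hyX, hyv.ne⟩, hyv⟩
    · have hwX : w ∉ X := fun h => hw ⟨h, hwv⟩
      by_cases haw : G.Adj a w
      · exact ⟨a, ⟨ha, fun h => hbv (h ▸ hab.symm)⟩, haw⟩
      by_cases hbw : G.Adj b w
      · exact ⟨b, ⟨hb, fun h => hav (h ▸ hab)⟩, hbw⟩
      obtain ⟨u, huX, huw⟩ := hdom w hwX
      refine ⟨u, ⟨huX, fun h => ?_⟩, huw⟩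
      have h' : u = v := h
      subst h'
      exact indep u w hav hbv haw hbw huw
  · rintro v ⟨⟨hav, hbv⟩, hvZ⟩
    by_contra hvX
    obtain ⟨u, huX, huv⟩ := hdom v hvX
    refine hvZ ⟨⟨hav, hbv⟩, u, ⟨huX, fun h => hav (h ▸ huv), fun h => hbv (h ▸ huv), ?_⟩, huv⟩
    by_contra hn
    rw [not_or] at hn
    exact indep u v hn.1 hn.2 hav hbv huv
end

section
/- Let G be a 2K2-free finite simple graph, let ab be an edge of G, and let X be a minimal dominating set of G with a, b ∈ X and |X| > α(G). With N, A, Y, Z defined as in the context, |Y| = |Z| and every vertex of Z is a private neighbour (with respect to X) of some vertex of Y. -/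
/-- In a `2K₂`-free graph with an edge `ab` and a minimal dominating set `X` containing `a`
and `b` with `|X| > α(G)`, with `N, A, Y, Z` as in the paper, `|Y| = |Z|` and every vertex
of `Z` is a private neighbour (w.r.t. `X`) of some vertex of `Y`. -/
theorem twoK2Free_claim3 {V : Type*} [Fintype V] (G : SimpleGraph V) (h2 : TwoK2Free G)
    (a b : V) (hab : G.Adj a b)
    (X : Set V) (hX : MinimalDominating G X) (ha : a ∈ X) (hb : b ∈ X)
    (hbig : indepNum G < X.ncard)
    (N A Y Z : Set V)
    (hN : N = {v : V | v ≠ a ∧ v ≠ b ∧ (G.Adj a v ∨ G.Adj b v)})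
    (hA : A = {v : V | ¬ G.Adj a v ∧ ¬ G.Adj b v})
    (hY : Y = X ∩ N)
    (hZ : Z = {v ∈ A | ∃ y ∈ Y, G.Adj y v}) :
    Y.ncard = Z.ncard ∧ ∀ z ∈ Z, ∃ y ∈ Y, PrivateNbr G X y z := by
  classical
  have key : ∀ x ∈ X, ∀ w ∈ X, G.Adj w x → ∃ p, PrivateNbr G X x p := by
    intro x hx w hw hwx
    have hnd := hX.2 (X \ {x}) (Set.diff_singleton_ssubset.2 hx)
    unfold Dominating at hnd
    push Not at hnd
    obtain ⟨v, hv, hvn⟩ := hnd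
    have hvx : v ≠ x := by
      rintro rfl
      exact hvn w ⟨hw, hwx.ne⟩ hwx
    have hvX : v ∉ X := fun h => hv ⟨h, hvx⟩
    have huniq : ∀ z ∈ X, G.Adj z v → z = x := by
      intro z hz hzv
      by_contra hne
      exact hvn z ⟨hz, hne⟩ hzv
    obtain ⟨u, hu, huv⟩ := hX.1 v hvX
    have := huniq u hu huv
    subst this
    exact ⟨v, hu, hvX, huv, huniq⟩
  have hAind : ∀ u ∈ A, ∀ v ∈ A, ¬ G.Adj u v := by
    intro u hu v hv huv
    rw [hA] at hu hv
    obtain ⟨hu1, hu2⟩ := hu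
    obtain ⟨hv1, hv2⟩ := hv
    rcases h2 a b u v hab huv (fun h => hu2 (h ▸ hab.symm)) (fun h => hv2 (h ▸ hab.symm))
      (fun h => hu1 (h ▸ hab)) (fun h => hv1 (h ▸ hab)) with h | h | h | h
    exacts [hu1 h, hv1 h, hu2 h, hv2 h]
  have haA : a ∉ A := by
    rw [hA]
    exact fun h => h.2 hab.symm
  -- a private neighbour of a vertex other than `a`, `b` lies in `A`
  have hprivA : ∀ x p, x ≠ a → x ≠ b → PrivateNbr G X x p → p ∈ A := by
    intro x p hxa hxb hp
    rw [hA]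
    exact ⟨fun h => hxa (hp.2.2.2 a ha h).symm, fun h => hxb (hp.2.2.2 b hb h).symm⟩
  have hYp : ∀ y, ∃ p, y ∈ Y → PrivateNbr G X y p := by
    intro y
    by_cases hy : y ∈ Y
    · have hy' := hy
      rw [hY, hN] at hy'
      obtain ⟨hyX, hya, hyb, h | h⟩ := hy'
      · obtain ⟨p, hp⟩ := key y hyX a ha h
        exact ⟨p, fun _ => hp⟩
      · obtain ⟨p, hp⟩ := key y hyX b hb h
        exact ⟨p, fun _ => hp⟩
    · exact ⟨y, fun h => absurd h hy⟩
  choose p hp using hYp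
  have hYne : ∀ y ∈ Y, y ∈ X ∧ y ≠ a ∧ y ≠ b := by
    intro y hy
    rw [hY, hN] at hy
    exact ⟨hy.1, hy.2.1, hy.2.2.1⟩
  have hsub : p '' Y ⊆ Z := by
    rintro _ ⟨y, hy, rfl⟩
    rw [hZ]
    exact ⟨hprivA y _ (hYne y hy).2.1 (hYne y hy).2.2 (hp y hy), y, hy, (hp y hy).2.2.1⟩
  have hinj : Set.InjOn p Y := by
    intro y hy y' hy' h
    have h1 := (hp y hy).2.2.1
    rw [h] at h1
    exact (hp y' hy').2.2.2 y (hYne y hy).1 h1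
  have hcard : (p '' Y).ncard = Y.ncard := Set.ncard_image_of_injOn hinj
  have hdisj : Disjoint Z (X ∩ A) := by
    rw [Set.disjoint_left]
    intro x hxZ hx
    rw [hZ] at hxZ
    obtain ⟨hxA, y, hy, hyx⟩ := hxZ
    obtain ⟨q, hq⟩ := key x hx.1 y (hYne y hy).1 hyx
    have hxa : x ≠ a := fun h => haA (h ▸ hxA)
    have hxb : x ≠ b := by
      rintro rfl
      rw [hA] at hxA
      exact hxA.1 hab
    exact hAind x hxA q (hprivA x q hxa hxb hq) hq.2.2.1
  have hZA : Z ∪ (X ∩ A) ⊆ A := by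
    rintro v (hv | hv)
    · rw [hZ] at hv
      exact hv.1
    · exact hv.2
  have hle1 : Z.ncard + (X ∩ A).ncard ≤ A.ncard := by
    rw [← Set.ncard_union_eq hdisj (Set.toFinite _) (Set.toFinite _)]
    exact Set.ncard_le_ncard hZA (Set.toFinite _)
  have hle2 : A.ncard + 1 ≤ indepNum G := by
    rw [← Set.ncard_insert_of_notMem haA (Set.toFinite _)]
    refine le_csSup ⟨(Set.univ : Set V).ncard, ?_⟩ ⟨insert a A, ?_, rfl⟩
    · rintro n ⟨S, -, rfl⟩
      exact Set.ncard_le_ncard (Set.subset_univ _) (Set.toFinite _)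
    · have haN : ∀ v ∈ A, ¬ G.Adj a v := by
        intro v hv
        rw [hA] at hv
        exact hv.1
      rintro u (rfl | hu) v (rfl | hv)
      · exact G.loopless.irrefl _
      · exact haN v hv
      · exact fun h => haN u hu h.symm
      · exact hAind u hu v hv
  have hle3 : X.ncard ≤ 2 + Y.ncard + (X ∩ A).ncard := by
    have hXs : X ⊆ ({a, b} ∪ Y) ∪ (X ∩ A) := by
      intro x hx
      by_cases hxA : x ∈ A
      · exact Or.inr ⟨hx, hxA⟩
      left
      by_cases hxa : x = a
      · exact Or.inl (Or.inl hxa)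
      by_cases hxb : x = b
      · exact Or.inl (Or.inr hxb)
      right
      rw [hY, hN]
      refine ⟨hx, hxa, hxb, ?_⟩
      by_contra hcon
      push Not at hcon
      exact hxA (by rw [hA]; exact hcon)
    have h1 := Set.ncard_le_ncard hXs (Set.toFinite _)
    have h2 := Set.ncard_union_le ({a, b} ∪ Y) (X ∩ A)
    have h3 := Set.ncard_union_le {a, b} Y
    have h4 : ({a, b} : Set V).ncard = 2 := Set.ncard_pair hab.ne
    omega
  have hZY : Z.ncard ≤ (p '' Y).ncard := by omega
  have heq : p '' Y = Z := Set.eq_of_subset_of_ncard_le hsub hZY (Set.toFinite _)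
  refine ⟨by rw [← heq, hcard], ?_⟩
  intro z hz
  rw [← heq] at hz
  obtain ⟨y, hy, rfl⟩ := hz
  exact ⟨y, hy, hp y hy⟩
end

section
/- Let G be a 2K2-free finite simple graph, let ab be an edge of G, and let X be a minimal dominating set of G with a, b ∈ X and |X| > α(G). With N and Y defined as in the context, Y consists of exactly one vertex, and this vertex is adjacent to both a and b. -/
theorem exists_private_aux {V : Type*} (G : SimpleGraph V) (X : Set V)
    (hX : MinimalDominating G X) (x : V) (hx : x ∈ X) (w : V) (hw : w ∈ X) (hwx : G.Adj w x) :
    ∃ v, v ∉ X ∧ G.Adj x v ∧ ∀ z ∈ X, G.Adj z v → z = x := by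
  have h1 : X \ {x} ⊂ X := by
    refine ⟨Set.diff_subset, fun h => ?_⟩
    exact (h hx).2 rfl
  have h2 := hX.2 _ h1
  unfold Dominating at h2
  push Not at h2
  obtain ⟨v, hv, hn⟩ := h2
  have hvx : v ≠ x := by
    rintro rfl
    exact hn w ⟨hw, hwx.ne⟩ hwx
  have hvX : v ∉ X := fun h => hv ⟨h, hvx⟩
  have huniq : ∀ z ∈ X, G.Adj z v → z = x := by
    intro z hz hzv
    by_contra hne
    exact hn z ⟨hz, hne⟩ hzv
  obtain ⟨u, hu, huv⟩ := hX.1 v hvX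
  have := huniq u hu huv
  subst this
  exact ⟨v, hvX, huv, huniq⟩

theorem indep_le_aux {V : Type*} [Fintype V] (G : SimpleGraph V) (S : Set V)
    (hS : IndepSet G S) : S.ncard ≤ indepNum G := by
  refine le_csSup ⟨Fintype.card V, ?_⟩ ⟨S, hS, rfl⟩
  rintro n ⟨T, -, rfl⟩
  rw [← Nat.card_eq_fintype_card]
  exact Set.ncard_le_card T

/-- The combinatorial core: only adjacency bookkeeping. -/
theorem core_aux {V : Type*} (G : SimpleGraph V) (h2 : TwoK2Free G) (H : Set V) (p : V → V)
    (hpH : ∀ x ∈ H, p x ∉ H) (hpa : ∀ x ∈ H, G.Adj x (p x))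
    (hpu : ∀ x ∈ H, ∀ z ∈ H, G.Adj z (p x) → z = x)
    (x y : V) (hx : x ∈ H) (hy : y ∈ H) (hxy : x ≠ y) (hpxy : G.Adj (p x) (p y))
    (F3 : ∀ x ∈ H, ∃ u ∈ H, ∃ v ∈ H, u ≠ x ∧ v ≠ x ∧ G.Adj u v) :
    ∃ s ∈ H, (∀ r ∈ H, r = x ∨ r = y ∨ r = s) ∧ G.Adj x s ∧ G.Adj y s ∧ G.Adj x y := by
  have hne : ∀ u ∈ H, ∀ v ∈ H, u ≠ p v := fun u hu v hv h => hpH v hv (h ▸ hu)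
  have hinj : ∀ u ∈ H, ∀ v ∈ H, u ≠ v → p u ≠ p v := by
    intro u hu v hv huv h
    exact huv (hpu v hv u hu (h ▸ hpa u hu))
  have F0 : ∀ u ∈ H, ∀ v ∈ H, ∀ w ∈ H, G.Adj u v → w ≠ u → w ≠ v → G.Adj w u ∨ G.Adj w v := by
    intro u hu v hv w hw huv h1 h3
    rcases h2 u v w (p w) huv (hpa w hw) h1.symm (hne u hu w hw) h3.symm (hne v hv w hw)
      with h | h | h | h
    · exact .inl h.symm
    · exact absurd (hpu w hw u hu h).symm h1
    · exact .inr h.symm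
    · exact absurd (hpu w hw v hv h).symm h3
  have F2 : ∀ x ∈ H, ∀ y ∈ H, G.Adj (p x) (p y) → ∀ u ∈ H, ∀ v ∈ H, G.Adj u v →
      u = x ∨ u = y ∨ v = x ∨ v = y := by
    intro x hx y hy hxy u hu v hv huv
    rcases h2 u v (p x) (p y) huv hxy (hne u hu x hx) (hne u hu y hy) (hne v hv x hx)
      (hne v hv y hy) with h | h | h | h
    · exact .inl (hpu x hx u hu h)
    · exact .inr (.inl (hpu y hy u hu h))
    · exact .inr (.inr (.inl (hpu x hx v hv h)))
    · exact .inr (.inr (.inr (hpu y hy v hv h)))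
  have F4 : ∀ u ∈ H, ∀ v ∈ H, u ≠ v → ¬ G.Adj u v → G.Adj (p u) (p v) := by
    intro u hu v hv huv hn
    rcases h2 u (p u) v (p v) (hpa u hu) (hpa v hv) huv (hne u hu v hv) (hne v hv u hu).symm
      (hinj u hu v hv huv) with h | h | h | h
    · exact absurd h hn
    · exact absurd (hpu v hv u hu h) huv
    · exact absurd (hpu u hu v hv h.symm).symm huv
    · exact h
  have claim : ∀ s ∈ H, ∀ t ∈ H, s ≠ x → s ≠ y → t ≠ x → t ≠ y → s = t := by
    intro s hs t ht hsx hsy htx hty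
    by_contra hst
    have nst : ¬ G.Adj s t := by
      intro h
      have := F2 x hx y hy hpxy s hs t ht h
      tauto
    have pst := F4 s hs t ht hst nst
    have nxy : ¬ G.Adj x y := by
      intro h
      rcases F2 s hs t ht pst x hx y hy h with h | h | h | h
      exacts [hsx h.symm, htx h.symm, hsy h.symm, hty h.symm]
    -- some edge between {x,y} and {s,t}
    obtain ⟨u, hu, v, hv, hux, hvx, huv⟩ := F3 x hx
    have e1 := F2 x hx y hy hpxy u hu v hv huv
    have e2 := F2 s hs t ht pst u hu v hv huv
    have hyst : G.Adj y s ∨ G.Adj y t := by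
      have := huv.symm
      rcases e1 with h | h | h | h <;> rcases e2 with h' | h' | h' | h' <;> subst h <;>
        first | (subst h'; tauto) | tauto
    have hxst : G.Adj x s ∨ G.Adj x t := by
      rcases hyst with h | h
      · have := F0 y hy s hs x hx h hxy hsx.symm
        tauto
      · have := F0 y hy t ht x hx h hxy htx.symm
        tauto
    have nts : ¬ G.Adj t s := fun h => nst h.symm
    have nyx : ¬ G.Adj y x := fun h => nxy h.symm
    have hys : G.Adj y s := by
      rcases hyst with h | h
      · exact h
      · have := F0 y hy t ht s hs h hsy hst
        exact (this.resolve_right nst).symm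
    have hyt : G.Adj y t := by
      have := F0 y hy s hs t ht hys hty (Ne.symm hst)
      exact (this.resolve_right nts).symm
    have hxs : G.Adj x s := (F0 y hy s hs x hx hys hxy hsx.symm).resolve_left nxy
    have hxt : G.Adj x t := (F0 y hy t ht x hx hyt hxy htx.symm).resolve_left nxy
    rcases h2 (p x) (p y) (p s) (p t) hpxy pst (hinj x hx s hs hsx.symm)
      (hinj x hx t ht htx.symm) (hinj y hy s hs hsy.symm) (hinj y hy t ht hty.symm)
      with h | h | h | h
    · have := F2 x hx s hs h y hy t ht hyt
      grind
    · have := F2 x hx t ht h y hy s hs hys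
      grind
    · have := F2 y hy s hs h x hx t ht hxt
      grind
    · have := F2 y hy t ht h x hx s hs hxs
      grind
  have key : ∀ x ∈ H, ∀ y ∈ H, G.Adj (p x) (p y) → ∃ s ∈ H, s ≠ x ∧ s ≠ y ∧ G.Adj y s := by
    intro x hx y hy hpxy
    obtain ⟨u, hu, v, hv, hux, hvx, huv⟩ := F3 x hx
    have := huv.ne
    have h' := huv.symm
    rcases F2 x hx y hy hpxy u hu v hv huv with h | h | h | h
    · exact absurd h hux
    · subst h; exact ⟨v, hv, hvx, this.symm, huv⟩
    · exact absurd h hvx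
    · subst h; exact ⟨u, hu, hux, this, h'⟩
  obtain ⟨s, hs, hsx, hsy, hys⟩ := key x hx y hy hpxy
  obtain ⟨t, ht, hty, htx, hxt⟩ := key y hy x hx hpxy.symm
  have := claim s hs t ht hsx hsy htx hty
  subst this
  have hall : ∀ r ∈ H, r = x ∨ r = y ∨ r = s := by
    intro r hr
    by_contra hc
    push Not at hc
    exact hc.2.2 (claim r hr s hs hc.1 hc.2.1 hsx hsy)
  refine ⟨s, hs, hall, hxt, hys, ?_⟩
  obtain ⟨u, hu, v, hv, hus, hvs, huv⟩ := F3 s hs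
  have h1 := huv.ne
  have h3 := huv.symm
  rcases hall u hu with h | h | h <;> rcases hall v hv with h' | h' | h' <;> subst h <;>
    first | (subst h'; tauto) | tauto

theorem twoK2Free_main_lemma {V : Type*} [Fintype V] (G : SimpleGraph V) (h2 : TwoK2Free G)
    (a b : V) (hab : G.Adj a b)
    (X : Set V) (hX : MinimalDominating G X) (ha : a ∈ X) (hb : b ∈ X)
    (hbig : indepNum G < X.ncard)
    (N Y : Set V)
    (hN : N = {v : V | v ≠ a ∧ v ≠ b ∧ (G.Adj a v ∨ G.Adj b v)})
    (hY : Y = X ∩ N) :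
    ∃ y : V, Y = {y} ∧ G.Adj a y ∧ G.Adj b y := by
  classical
  set H : Set V := {v | v ∈ X ∧ (G.Adj a v ∨ G.Adj b v)} with hH
  have haH : a ∈ H := ⟨ha, .inr hab.symm⟩
  have hbH : b ∈ H := ⟨hb, .inl hab⟩
  have hHX : H ⊆ X := fun v hv => hv.1
  have hex : ∀ x ∈ H, ∃ v, v ∉ X ∧ G.Adj x v ∧ ∀ z ∈ X, G.Adj z v → z = x := by
    rintro x ⟨hx, h | h⟩
    · exact exists_private_aux G X hX x hx a ha h
    · exact exists_private_aux G X hX x hx b hb h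
  choose! p hpX hpa hpu using hex
  -- vertices of X outside H are isolated in X
  have hiso : ∀ z ∈ X \ H, ∀ w ∈ X, ¬ G.Adj z w := by
    intro z hz w hw hzw
    have hza : z ≠ a := fun h => hz.2 (h ▸ haH)
    have hzb : z ≠ b := fun h => hz.2 (h ▸ hbH)
    obtain ⟨q, hqX, hzq, hqu⟩ := exists_private_aux G X hX z hz.1 w hw hzw.symm
    rcases h2 a b z q hab hzq hza.symm (fun h => hqX (h ▸ ha)) hzb.symm (fun h => hqX (h ▸ hb))
      with h | h | h | h
    · exact hz.2 ⟨hz.1, .inl h⟩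
    · exact hza (hqu a ha h).symm
    · exact hz.2 ⟨hz.1, .inr h⟩
    · exact hzb (hqu b hb h).symm
  have hT : ∀ T : Set V, IndepSet G T → T ⊆ H ∪ p '' H → T.ncard < H.ncard := by
    intro T hTi hTs
    have hcross : ∀ z ∈ X \ H, ∀ t ∈ T, ¬ G.Adj z t := by
      intro z hz t ht hzt
      rcases hTs ht with h | ⟨x, hx, rfl⟩
      · exact hiso z hz t h.1 hzt
      · exact hz.2 (hpu x hx z hz.1 hzt ▸ hx)
    have hind : IndepSet G (T ∪ (X \ H)) := by
      rintro u (hu | hu) v (hv | hv) huv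
      · exact hTi u hu v hv huv
      · exact hcross v hv u hu huv.symm
      · exact hcross u hu v hv huv
      · exact hiso u hu v hv.1 huv
    have hdisj : Disjoint T (X \ H) := by
      rw [Set.disjoint_left]
      intro t ht htz
      rcases hTs ht with h | ⟨x, hx, rfl⟩
      · exact htz.2 h
      · exact hpX x hx htz.1
    have h1 := indep_le_aux G _ hind
    rw [Set.ncard_union_eq hdisj (Set.toFinite _) (Set.toFinite _)] at h1
    have h3 := Set.ncard_diff_add_ncard_of_subset hHX (Set.toFinite X)
    omega
  have hinj : Set.InjOn p H := by
    intro u hu v hv h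
    exact hpu v hv u hu.1 (h ▸ hpa u hu)
  have F1 : ∃ x ∈ H, ∃ y ∈ H, G.Adj (p x) (p y) := by
    by_contra hc
    push Not at hc
    have := hT (p '' H) (by
      rintro _ ⟨u, hu, rfl⟩ _ ⟨v, hv, rfl⟩
      exact hc u hu v hv) Set.subset_union_right
    rw [Set.ncard_image_of_injOn hinj] at this
    exact lt_irrefl _ this
  have F3 : ∀ x ∈ H, ∃ u ∈ H, ∃ v ∈ H, u ≠ x ∧ v ≠ x ∧ G.Adj u v := by
    intro x hx
    by_contra hc
    push Not at hc
    have h1 := hT (insert (p x) (H \ {x})) (by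
      rintro u (rfl | hu) v (rfl | hv) huv
      · exact G.loopless.irrefl _ huv
      · exact hv.2 (hpu x hx v hv.1.1 huv.symm)
      · exact hu.2 (hpu x hx u hu.1.1 huv)
      · exact hc u hu.1 v hv.1 hu.2 hv.2 huv) (by
      rintro u (rfl | hu)
      · exact .inr ⟨x, hx, rfl⟩
      · exact .inl hu.1)
    rw [Set.ncard_insert_of_notMem (fun h => hpX x hx h.1.1),
      Set.ncard_diff_singleton_add_one hx (Set.toFinite _)] at h1
    exact lt_irrefl _ h1
  obtain ⟨x, hx, y, hy, hpxy⟩ := F1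
  have hxy : x ≠ y := by
    rintro rfl
    exact G.loopless.irrefl _ hpxy
  obtain ⟨s, hs, hall, hxs, hys, hxy'⟩ := core_aux G h2 H p (fun x hx h => hpX x hx h.1) hpa
    (fun x hx z hz => hpu x hx z hz.1) x y hx hy hxy hpxy F3
  have hYH : ∀ v, v ∈ Y ↔ v ∈ H ∧ v ≠ a ∧ v ≠ b := by
    intro v
    rw [hY, hN, hH]
    simp only [Set.mem_inter_iff, Set.mem_setOf_eq]
    tauto
  have fin : ∀ c ∈ H, G.Adj a c → G.Adj b c → (∀ r ∈ H, r = a ∨ r = b ∨ r = c) →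
      ∃ y : V, Y = {y} ∧ G.Adj a y ∧ G.Adj b y := by
    intro c hc hac hbc hr
    refine ⟨c, ?_, hac, hbc⟩
    ext v
    rw [hYH, Set.mem_singleton_iff]
    constructor
    · rintro ⟨h, h1, h3⟩
      have := hr v h
      tauto
    · rintro rfl
      exact ⟨hc, hac.ne', hbc.ne'⟩
  have hne := hab.ne
  rcases hall a haH with h | h | h <;> rcases hall b hbH with h' | h' | h'
  · exact absurd (h.trans h'.symm) hne
  · subst h h'; exact fin s hs hxs hys hall
  · subst h h'; exact fin y hy hxy' hys.symm (fun r hr => by have := hall r hr; tauto)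
  · subst h h'; exact fin s hs hys hxs (fun r hr => by have := hall r hr; tauto)
  · exact absurd (h.trans h'.symm) hne
  · subst h h'; exact fin x hx hxy'.symm hxs.symm (fun r hr => by have := hall r hr; tauto)
  · subst h h'; exact fin y hy hys.symm hxy' (fun r hr => by have := hall r hr; tauto)
  · subst h h'; exact fin x hx hxs.symm hxy'.symm (fun r hr => by have := hall r hr; tauto)
  · exact absurd (h.trans h'.symm) hne
end

section
/- Let G be a 2K2-free finite simple graph and let X be a minimal dominating set of G with |X| > α(G). Then there exist three pairwise adjacent vertices of G forming a triangle T ⊆ X such that X = T ∪ A(T), where A(T) denotes the set of vertices of G not in T having no neighbour in T. -/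
/-- `A(U)`: the set of vertices outside `U` having no neighbour in `U`. -/
def antiNbhd {V : Type*} (G : SimpleGraph V) (U : Set V) : Set V :=
  {v : V | v ∉ U ∧ ∀ u ∈ U, ¬ G.Adj u v}


lemma exists_private_s18 {V : Type*} {G : SimpleGraph V} {X : Set V} (hX : MinimalDominating G X)
    (x : V) : ∃ p, (x ∈ X ∧ ∃ y ∈ X, G.Adj x y) → PrivateNbr G X x p := by
  by_cases h : x ∈ X ∧ ∃ y ∈ X, G.Adj x y
  · obtain ⟨hx, y, hy, hxy⟩ := h
    have h1 := hX.2 (X \ {x}) ⟨Set.sdiff_subset, fun hh => (hh hx).2 rfl⟩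
    unfold Dominating at h1
    push Not at h1
    obtain ⟨v, hv, hn⟩ := h1
    have hvx : v ≠ x := by
      rintro rfl
      exact hn y ⟨hy, hxy.ne'⟩ hxy.symm
    have hvX : v ∉ X := fun h => hv ⟨h, hvx⟩
    obtain ⟨u, hu, huv⟩ := hX.1 v hvX
    have key : ∀ z ∈ X, G.Adj z v → z = x := fun z hz hzv => by
      by_contra hne
      exact hn z ⟨hz, hne⟩ hzv
    have := key u hu huv
    subst this
    exact ⟨v, fun _ => ⟨hx, hvX, huv, key⟩⟩
  · exact ⟨x, fun h' => absurd h' h⟩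

lemma indep_le {V : Type*} [Fintype V] {G : SimpleGraph V} {S : Set V} (hS : IndepSet G S) :
    S.ncard ≤ indepNum G := by
  refine le_csSup ⟨Fintype.card V, ?_⟩ ⟨S, hS, rfl⟩
  rintro n ⟨T, -, rfl⟩
  rw [← Nat.card_eq_fintype_card, ← Set.ncard_univ]
  exact Set.ncard_le_ncard (Set.subset_univ _)

/-- Replacing the vertices of `Y` by their private neighbours. -/
lemma replace_lemma {V : Type*} [Fintype V] {G : SimpleGraph V} {X Y : Set V} {p : V → V}
    (hbig : indepNum G < X.ncard) (hp : ∀ y ∈ Y, PrivateNbr G X y (p y)) :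
    (∃ a ∈ X, ∃ b ∈ X, a ∉ Y ∧ b ∉ Y ∧ G.Adj a b) ∨
      ∃ a ∈ Y, ∃ b ∈ Y, G.Adj (p a) (p b) := by
  classical
  by_contra hcon
  push Not at hcon
  obtain ⟨h1, h2⟩ := hcon
  let f : V → V := fun v => if v ∈ Y then p v else v
  have hinj : Set.InjOn f X := by
    intro a ha b hb hab
    by_cases hay : a ∈ Y <;> by_cases hby : b ∈ Y <;> simp only [f, hay, hby, if_true, if_false] at hab
    · exact (hp b hby).2.2.2 a ha (hab ▸ (hp a hay).2.2.1)
    · exact absurd (hab ▸ hb) (hp a hay).2.1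
    · exact absurd (hab ▸ ha) (hp b hby).2.1
    · exact hab
  have hind : IndepSet G (Set.image f X) := by
    rintro _ ⟨a, ha, rfl⟩ _ ⟨b, hb, rfl⟩ hab
    by_cases hay : a ∈ Y <;> by_cases hby : b ∈ Y <;> simp only [f, hay, hby, if_true, if_false] at hab
    · exact h2 a hay b hby hab
    · exact hby ((hp a hay).2.2.2 b hb hab.symm ▸ hay)
    · exact hay ((hp b hby).2.2.2 a ha hab ▸ hby)
    · exact h1 a ha b hb hay hby hab
  have := indep_le hind
  rw [Set.ncard_image_of_injOn hinj] at this
  omega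

/-- Non-adjacent non-isolated vertices of `X` have adjacent private neighbours. -/
lemma private_adj {V : Type*} {G : SimpleGraph V} (h2 : TwoK2Free G) {X : Set V} {a b pa pb : V}
    (ha : PrivateNbr G X a pa) (hb : PrivateNbr G X b pb) (hne : a ≠ b) (hn : ¬ G.Adj a b) :
    G.Adj pa pb := by
  obtain ⟨a1, a2, a3, a4⟩ := ha
  obtain ⟨b1, b2, b3, b4⟩ := hb
  rcases h2 a pa b pb a3 b3 hne (fun h => b2 (h ▸ a1)) (fun h => a2 (h ▸ b1))
    (fun h => hne (b4 a a1 (h ▸ a3))) with h | h | h | h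
  · exact absurd h hn
  · exact absurd (b4 a a1 h) hne
  · exact absurd (a4 b b1 h.symm).symm hne
  · exact h

lemma edge_meets {V : Type*} {G : SimpleGraph V} (h2 : TwoK2Free G) {X : Set V} {a b pa pb : V}
    (ha : PrivateNbr G X a pa) (hb : PrivateNbr G X b pb) (hadj : G.Adj pa pb)
    {u v : V} (hu : u ∈ X) (hv : v ∈ X) (huv : G.Adj u v) :
    u = a ∨ u = b ∨ v = a ∨ v = b := by
  obtain ⟨a1, a2, a3, a4⟩ := ha
  obtain ⟨b1, b2, b3, b4⟩ := hb
  rcases h2 u v pa pb huv hadj (fun h => a2 (h ▸ hu)) (fun h => b2 (h ▸ hu))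
    (fun h => a2 (h ▸ hv)) (fun h => b2 (h ▸ hv)) with h | h | h | h
  · exact Or.inl (a4 u hu h)
  · exact Or.inr (Or.inl (b4 u hu h))
  · exact Or.inr (Or.inr (Or.inl (a4 v hv h)))
  · exact Or.inr (Or.inr (Or.inr (b4 v hv h)))

lemma four_aux {V : Type*} {G : SimpleGraph V} (h2 : TwoK2Free G) {X : Set V} {a b c d pa pb pc pd : V}
    (ha : PrivateNbr G X a pa) (hb : PrivateNbr G X b pb)
    (hc : PrivateNbr G X c pc) (hd : PrivateNbr G X d pd)
    (hab : a ≠ b) (hac' : a ≠ c) (had : a ≠ d) (hbc : b ≠ c) (hbd' : b ≠ d) (hcd : c ≠ d)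
    (h1 : G.Adj pa pb) (h3 : G.Adj pc pd) (hac : G.Adj a c) (hbd : G.Adj b d)
    (hx : G.Adj pa pd) : False := by
  have m1 := fun h => edge_meets h2 ha hd hx hb.1 hc.1 h
  have nbc : ¬ G.Adj b c := fun h => by grind
  have q := private_adj h2 hb hc hbc nbc
  have n1 : ¬ G.Adj a d := fun h => by grind [edge_meets h2 hb hc q ha.1 hd.1 h]
  have n2 : ¬ G.Adj a b := fun h => by grind [edge_meets h2 hc hd h3 ha.1 hb.1 h]
  have n3 : ¬ G.Adj c d := fun h => by grind [edge_meets h2 ha hb h1 hc.1 hd.1 h]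
  rcases h2 a c b d hac hbd hab had hbc.symm hcd with h | h | h | h
  · exact n2 h
  · exact n1 h
  · exact nbc h.symm
  · exact n3 h

lemma four_false {V : Type*} {G : SimpleGraph V} (h2 : TwoK2Free G) {X : Set V}
    {a b c d pa pb pc pd : V}
    (ha : PrivateNbr G X a pa) (hb : PrivateNbr G X b pb)
    (hc : PrivateNbr G X c pc) (hd : PrivateNbr G X d pd)
    (hab : a ≠ b) (hac' : a ≠ c) (had : a ≠ d) (hbc : b ≠ c) (hbd' : b ≠ d) (hcd : c ≠ d)
    (h1 : G.Adj pa pb) (h3 : G.Adj pc pd) (hac : G.Adj a c) (hbd : G.Adj b d) : False := by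
  have inj : ∀ {u v pu pv : V}, PrivateNbr G X u pu → PrivateNbr G X v pv → u ≠ v → pu ≠ pv := by
    intro u v pu pv hu hv huv h
    exact huv (hv.2.2.2 u hu.1 (h ▸ hu.2.2.1))
  rcases h2 pa pb pc pd h1 h3 (inj ha hc hac') (inj ha hd had) (inj hb hc hbc) (inj hb hd hbd')
    with h | h | h | h
  · grind [edge_meets h2 ha hc h hb.1 hd.1 hbd]
  · exact four_aux h2 ha hb hc hd hab hac' had hbc hbd' hcd h1 h3 hac hbd h
  · exact four_aux h2 hb ha hd hc hab.symm hbd' hbc had hac' hcd.symm h1.symm h3.symm hbd hac h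
  · grind [edge_meets h2 hb hd h ha.1 hc.1 hac]

/-- In a `2K₂`-free graph, every minimal dominating set `X` with `|X| > α(G)` consists of a
triangle `T ⊆ X` together with all vertices not dominated by `T`. -/
theorem twoK2Free_corollary {V : Type*} [Fintype V] (G : SimpleGraph V) (h2 : TwoK2Free G)
    (X : Set V) (hX : MinimalDominating G X) (hbig : indepNum G < X.ncard) :
    ∃ x y z : V, G.Adj x y ∧ G.Adj x z ∧ G.Adj y z ∧
      ({x, y, z} : Set V) ⊆ X ∧
      X = {x, y, z} ∪ antiNbhd G {x, y, z} := by
  choose p hp' using exists_private_s18 hX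
  have hp : ∀ {x y}, x ∈ X → y ∈ X → G.Adj x y → PrivateNbr G X x (p x) :=
    fun hx hy h => hp' _ ⟨hx, _, hy, h⟩
  have single : ∀ y, PrivateNbr G X y (p y) → ∃ a ∈ X, ∃ b ∈ X, a ≠ y ∧ b ≠ y ∧ G.Adj a b := by
    intro y hy
    rcases replace_lemma (Y := {y}) (p := p) hbig (by rintro _ rfl; exact hy) with h | h
    · simpa using h
    · obtain ⟨a, rfl, b, rfl, h⟩ := h
      exact absurd h (G.loopless.irrefl _)
  obtain ⟨x, x', hx, hx', hxx⟩ : ∃ x x', PrivateNbr G X x (p x) ∧ PrivateNbr G X x' (p x') ∧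
      G.Adj (p x) (p x') := by
    rcases replace_lemma (Y := {x | x ∈ X ∧ ∃ y ∈ X, G.Adj x y}) (p := p) hbig
      (fun y hy => hp' y hy) with ⟨a, ha, b, hb, h1, -, h⟩ | ⟨a, ha, b, hb, h⟩
    · exact absurd ⟨ha, b, hb, h⟩ h1
    · exact ⟨a, b, hp' a ha, hp' b hb, h⟩
  have hne : x ≠ x' := by rintro rfl; exact G.loopless.irrefl _ hxx
  have meets := fun {u v : V} => @edge_meets V G h2 X x x' _ _ hx hx' hxx u v
  obtain ⟨s, hs, hsx, hsx', hs'⟩ : ∃ s ∈ X, s ≠ x ∧ s ≠ x' ∧ G.Adj x' s := by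
    obtain ⟨a, ha, b, hb, h1, h3, h⟩ := single x hx
    rcases meets ha hb h with rfl | rfl | rfl | rfl
    · exact absurd rfl h1
    · exact ⟨b, hb, h3, h.ne', h⟩
    · exact absurd rfl h3
    · exact ⟨a, ha, h1, h.ne, h.symm⟩
  obtain ⟨t, ht, htx, htx', ht'⟩ : ∃ s ∈ X, s ≠ x ∧ s ≠ x' ∧ G.Adj x s := by
    obtain ⟨a, ha, b, hb, h1, h3, h⟩ := single x' hx'
    rcases meets ha hb h with rfl | rfl | rfl | rfl
    · exact ⟨b, hb, h.ne', h3, h⟩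
    · exact absurd rfl h1
    · exact ⟨a, ha, h.ne, h1, h.symm⟩
    · exact absurd rfl h3
  have ps := hp hs hx'.1 hs'.symm
  have pt := hp ht hx.1 ht'.symm
  have fin : ∀ {u v w z : V}, (u = x ∧ v = x' ∨ u = x' ∧ v = x) → w ∈ X → z ∈ X → w ≠ x → w ≠ x' →
      z ≠ x → z ≠ x' → w ≠ z → G.Adj u w → G.Adj v z → False := by
    intro u v w z huv hw hz w1 w2 z1 z2 hwz h1 h3
    have huX : u ∈ X := h1 |> fun _ => by rcases huv with ⟨rfl, rfl⟩ | ⟨rfl, rfl⟩; exacts [hx.1, hx'.1]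
    have hvX : v ∈ X := by rcases huv with ⟨rfl, rfl⟩ | ⟨rfl, rfl⟩; exacts [hx'.1, hx.1]
    have pw := hp hw huX h1.symm
    have pz := hp hz hvX h3.symm
    have nwz : ¬ G.Adj w z := fun h => by grind [meets hw hz h]
    have q := private_adj h2 pw pz hwz nwz
    rcases huv with ⟨rfl, rfl⟩ | ⟨rfl, rfl⟩
    · exact four_false h2 hx hx' pw pz hne w1.symm z1.symm w2.symm z2.symm hwz hxx q h1 h3
    · exact four_false h2 hx' hx pw pz hne.symm w2.symm z2.symm w1.symm z1.symm hwz hxx.symm q h1 h3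
  have hst : s = t := by
    by_contra h
    exact fin (Or.inr ⟨rfl, rfl⟩) hs ht hsx hsx' htx htx' h hs' ht'
  subst hst
  have hadj : G.Adj x x' := by
    obtain ⟨a, ha, b, hb, h1, h3, h⟩ := single s ps
    by_contra hcon
    have aux : ∀ w ∈ X, w ≠ s → w ≠ x → w ≠ x' → ¬ G.Adj x w ∧ ¬ G.Adj x' w := by
      intro w hw w1 w2 w3
      exact ⟨fun h => fin (Or.inl ⟨rfl, rfl⟩) hw hs w2 w3 hsx hsx' w1 h hs',
        fun h => fin (Or.inr ⟨rfl, rfl⟩) hw hs w2 w3 hsx hsx' w1 h ht'⟩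
    have hs := h.symm
    have := h.ne
    rcases meets ha hb h with rfl | rfl | rfl | rfl <;> grind
  refine ⟨x, x', s, hadj, ht', hs', ?_, ?_⟩
  · rintro v (rfl | rfl | rfl)
    exacts [hx.1, hx'.1, hs]
  · ext v
    constructor
    · intro hv
      by_cases hvT : v ∈ ({x, x', s} : Set V)
      · exact Or.inl hvT
      · refine Or.inr ⟨hvT, ?_⟩
        simp only [Set.mem_insert_iff, Set.mem_singleton_iff, not_or] at hvT
        obtain ⟨v1, v2, v3⟩ := hvT
        rintro u (rfl | rfl | rfl) h
        · exact fin (Or.inl ⟨rfl, rfl⟩) hv hs v1 v2 hsx hsx' v3 h hs'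
        · exact fin (Or.inr ⟨rfl, rfl⟩) hv hs v1 v2 hsx hsx' v3 h ht'
        · grind [meets hs hv h]
    · rintro (hv | ⟨hvT, hv⟩)
      · rcases hv with rfl | rfl | rfl
        exacts [hx.1, hx'.1, hs]
      · by_contra hvX
        simp only [Set.mem_insert_iff, Set.mem_singleton_iff, not_or] at hvT
        obtain ⟨v1, v2, v3⟩ := hvT
        obtain ⟨i, hi, hiv⟩ := hX.1 v hvX
        have nx := hv x (by simp)
        have nx' := hv x' (by simp)
        have ns := hv s (by simp)
        have ix : i ≠ x := by rintro rfl; exact nx hiv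
        have ix' : i ≠ x' := by rintro rfl; exact nx' hiv
        have is : i ≠ s := by rintro rfl; exact ns hiv
        rcases h2 x x' i v hadj hiv ix.symm (Ne.symm v1) ix'.symm (Ne.symm v2) with h | h | h | h
        · exact fin (Or.inl ⟨rfl, rfl⟩) hi hs ix ix' hsx hsx' is h hs'
        · exact nx h
        · exact fin (Or.inr ⟨rfl, rfl⟩) hi hs ix ix' hsx hsx' is h ht'
        · exact nx' h
end

section
/- Let G be a 2K2-free finite simple graph. Then the upper domination number Γ(G) equals the maximum of α(G) and the largest cardinality of a set of the form T ∪ A(T) that is a minimal dominating set of G, where T ranges over all triangles (sets of three pairwise adjacent vertices) of G and A(T) denotes the set of vertices of G not in T having no neighbour in T (the second quantity being taken as 0 if no such set exists). -/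
/-- `Γ(G)`: the maximum cardinality of a minimal dominating set (upper domination number). -/
noncomputable def upperDomNum {V : Type*} (G : SimpleGraph V) : ℕ :=
  sSup {n | ∃ D : Set V, MinimalDominating G D ∧ D.ncard = n}

theorem aux_bdd {V : Type*} [Fintype V] (Q : Set V → Prop) :
    BddAbove {n | ∃ D : Set V, Q D ∧ D.ncard = n} := by
  refine ⟨Nat.card V, ?_⟩
  rintro n ⟨D, _, rfl⟩
  exact Set.ncard_le_card D

theorem aux_indep_le {V : Type*} [Fintype V] (G : SimpleGraph V) (S : Set V)
    (h : IndepSet G S) : S.ncard ≤ indepNum G :=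
  le_csSup (aux_bdd (IndepSet G)) ⟨S, h, rfl⟩

theorem aux_dom_le {V : Type*} [Fintype V] (G : SimpleGraph V) (S : Set V)
    (h : MinimalDominating G S) : S.ncard ≤ upperDomNum G :=
  le_csSup (aux_bdd (MinimalDominating G)) ⟨S, h, rfl⟩

theorem aux_indep_dom {V : Type*} [Fintype V] (G : SimpleGraph V) :
    indepNum G ≤ upperDomNum G := by
  have hne : {n | ∃ S : Set V, IndepSet G S ∧ S.ncard = n}.Nonempty :=
    ⟨0, ∅, by intro u hu; simp at hu, by simp⟩
  obtain ⟨S, hS, hc⟩ := Nat.sSup_mem hne (aux_bdd (IndepSet G))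
  have hc' : S.ncard = indepNum G := hc
  rw [← hc']
  apply aux_dom_le
  constructor
  · intro v hv
    by_contra hcon
    push Not at hcon
    have h1 : IndepSet G (insert v S) := by
      intro a ha b hb hab
      rcases ha with rfl | ha <;> rcases hb with rfl | hb
      · exact G.irrefl hab
      · exact hcon b hb hab.symm
      · exact hcon a ha hab
      · exact hS a ha b hb hab
    have h3 := aux_indep_le G _ h1
    rw [Set.ncard_insert_of_notMem hv, hc'] at h3
    omega
  · intro D' hD' hdom
    obtain ⟨hsub, x, hx, hxD⟩ := Set.ssubset_iff_exists.1 hD'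
    obtain ⟨u, hu, hux⟩ := hdom x hxD
    exact hS u (hsub hu) x hx hux

/-- Replacing the non-isolated part of `D` by an independent set of at least the same size. -/
theorem aux_replace {V : Type*} [Fintype V] (G : SimpleGraph V) (D X S : Set V)
    (hcard : X.ncard ≤ S.ncard) (hS : IndepSet G S)
    (hI : IndepSet G (D \ X))
    (hSI : ∀ s ∈ S, ∀ i ∈ D \ X, s ≠ i ∧ ¬ G.Adj s i) : D.ncard ≤ indepNum G := by
  have h1 : IndepSet G (S ∪ (D \ X)) := by
    rintro a (ha | ha) b (hb | hb) hab
    · exact hS a ha b hb hab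
    · exact (hSI a ha b hb).2 hab
    · exact (hSI b hb a ha).2 hab.symm
    · exact hI a ha b hb hab
  have hd : Disjoint S (D \ X) := by
    rw [Set.disjoint_left]
    intro a ha hb
    exact (hSI a ha a hb).1 rfl
  have h3 := aux_indep_le G _ h1
  rw [Set.ncard_union_eq hd] at h3
  have h4 := Set.ncard_le_ncard_diff_add_ncard D X
  omega

theorem aux_private {V : Type*} (G : SimpleGraph V) (D : Set V)
    (hD : MinimalDominating G D) (x : V) (hx : x ∈ D) (hn : ∃ y ∈ D, G.Adj x y) :
    ∃ p, PrivateNbr G D x p := by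
  obtain ⟨y, hy, hxy⟩ := hn
  have h := hD.2 (D \ {x}) (by
    refine Set.ssubset_iff_exists.2 ⟨Set.diff_subset, x, hx, by simp⟩)
  unfold Dominating at h
  push Not at h
  obtain ⟨v, hv, hv2⟩ := h
  have hvx : v ≠ x := by
    rintro rfl
    exact hv2 y ⟨hy, fun h => hxy.ne h.symm⟩ hxy.symm
  have hvD : v ∉ D := fun h => hv ⟨h, hvx⟩
  have key : ∀ z ∈ D, G.Adj z v → z = x := by
    intro z hz hzv
    by_contra hne
    exact hv2 z ⟨hz, hne⟩ hzv
  obtain ⟨u, hu, huv⟩ := hD.1 v hvD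
  have := key u hu huv
  subst this
  exact ⟨v, hu, hvD, huv, key⟩

theorem aux_main {V : Type*} [Fintype V] (G : SimpleGraph V)
    (h2 : TwoK2Free G) (D : Set V) (hD : MinimalDominating G D) :
    D.ncard ≤ indepNum G ∨ ∃ x y z : V, G.Adj x y ∧ G.Adj x z ∧ G.Adj y z ∧
      D = ({x, y, z} : Set V) ∪ antiNbhd G {x, y, z} := by
  classical
  have hX : ∃ X : Set V, X = {x | x ∈ D ∧ ∃ y ∈ D, G.Adj x y} := ⟨_, rfl⟩
  obtain ⟨X, hX⟩ := hX
  have memX : ∀ x, x ∈ X ↔ x ∈ D ∧ ∃ y ∈ D, G.Adj x y := by intro x; rw [hX]; rfl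
  have hpe : ∀ x, ∃ p, x ∈ X → PrivateNbr G D x p := by
    intro x
    by_cases hx : x ∈ X
    · obtain ⟨p, hp⟩ := aux_private G D hD x ((memX x).1 hx).1 ((memX x).1 hx).2
      exact ⟨p, fun _ => hp⟩
    · exact ⟨x, fun h => absurd h hx⟩
  choose p hp using hpe
  have XD : ∀ x ∈ X, x ∈ D := fun x hx => ((memX x).1 hx).1
  have pD : ∀ x ∈ X, p x ∉ D := fun x hx => (hp x hx).2.1
  have pa : ∀ x ∈ X, G.Adj x (p x) := fun x hx => (hp x hx).2.2.1
  have pu : ∀ x ∈ X, ∀ z ∈ D, G.Adj z (p x) → z = x := fun x hx => (hp x hx).2.2.2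
  have iso : ∀ i ∈ D \ X, ∀ z ∈ D, ¬ G.Adj z i := by
    intro i hi z hz h
    exact hi.2 ((memX i).2 ⟨hi.1, z, hz, h.symm⟩)
  have nbr : ∀ x ∈ X, ∃ y ∈ X, G.Adj x y := by
    intro x hx
    obtain ⟨hxD, y, hy, hxy⟩ := (memX x).1 hx
    exact ⟨y, (memX y).2 ⟨hy, x, hxD, hxy.symm⟩, hxy⟩
  have indI : IndepSet G (D \ X) := fun a ha b hb => iso b hb a ha.1
  have XI : ∀ s ∈ X, ∀ i ∈ D \ X, s ≠ i ∧ ¬ G.Adj s i := by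
    intro s hs i hi
    exact ⟨fun h => hi.2 (h ▸ hs), iso i hi s (XD s hs)⟩
  have PI : ∀ s ∈ X, ∀ i ∈ D \ X, p s ≠ i ∧ ¬ G.Adj (p s) i := by
    intro s hs i hi
    exact ⟨fun h => pD s hs (h ▸ hi.1), fun h => hi.2 (pu s hs i hi.1 h.symm ▸ hs)⟩
  have pne : ∀ x ∈ X, ∀ y ∈ D, y ≠ p x := fun x hx y hy h => pD x hx (h ▸ hy)
  have pinj : ∀ x ∈ X, ∀ y ∈ X, p x = p y → x = y := by
    intro x hx y hy h
    exact pu y hy x (XD x hx) (h ▸ pa x hx)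
  have pna : ∀ x ∈ X, ∀ y ∈ X, y ≠ x → ¬ G.Adj y (p x) :=
    fun x hx y hy hne h => hne (pu x hx y (XD y hy) h)
  -- non-adjacent vertices of X have adjacent private neighbours
  have F1 : ∀ x ∈ X, ∀ y ∈ X, x ≠ y → ¬ G.Adj x y → G.Adj (p x) (p y) := by
    intro x hx y hy hne hxy
    rcases h2 x (p x) y (p y) (pa x hx) (pa y hy) hne (pne y hy x (XD x hx))
      (pne x hx y (XD y hy)).symm (fun h => hne (pinj x hx y hy h)) with h | h | h | h
    · exact absurd h hxy
    · exact absurd h (pna y hy x hx hne)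
    · exact absurd h.symm (pna x hx y hy hne.symm)
    · exact h
  -- an edge in X dominates X
  have F2 : ∀ x ∈ X, ∀ y ∈ X, ∀ z ∈ X, G.Adj x y → z ≠ x → z ≠ y →
      G.Adj x z ∨ G.Adj y z := by
    intro x hx y hy z hz hxy hzx hzy
    rcases h2 x y z (p z) hxy (pa z hz) hzx.symm (pne z hz x (XD x hx))
      hzy.symm (pne z hz y (XD y hy)) with h | h | h | h
    · exact Or.inl h
    · exact absurd h (pna z hz x hx hzx.symm)
    · exact Or.inr h
    · exact absurd h (pna z hz y hy hzy.symm)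
  -- adjacent private neighbours: every edge of X meets the pair
  have F3 : ∀ x ∈ X, ∀ y ∈ X, ∀ z ∈ X, ∀ w ∈ X, G.Adj (p x) (p y) → G.Adj z w →
      z ≠ x → z ≠ y → w ≠ x → w ≠ y → False := by
    intro x hx y hy z hz w hw hxy hzw h1 h3 h4 h5
    rcases h2 z w (p x) (p y) hzw hxy (pne x hx z (XD z hz)) (pne y hy z (XD z hz))
      (pne x hx w (XD w hw)) (pne y hy w (XD w hw)) with h | h | h | h
    · exact pna x hx z hz h1 h
    · exact pna y hy z hz h3 h
    · exact pna x hx w hw h4 h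
    · exact pna y hy w hw h5 h
  -- paths with three vertices
  have path : ∀ a ∈ X, ∀ b ∈ X, ∀ c ∈ X, a ≠ b → c ≠ a → c ≠ b → ¬ G.Adj a b →
      X ⊆ {a, b, c} → D.ncard ≤ indepNum G := by
    intro a ha b hb c hc hab hca hcb hnab hsub
    have e1 := pna c hc a ha hca.symm
    have e2 := pna c hc b hb hcb.symm
    have n1 := pne c hc a (XD a ha)
    have n2 := pne c hc b (XD b hb)
    refine aux_replace G D X {a, b, p c} ?_ ?_ indI ?_
    · have t1 := Set.ncard_le_ncard hsub (Set.toFinite _)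
      have t2 : ({a, b, c} : Set V).ncard = 3 :=
        Set.ncard_eq_three.2 ⟨a, b, c, hab, hca.symm, hcb.symm, rfl⟩
      have t3 : ({a, b, p c} : Set V).ncard = 3 :=
        Set.ncard_eq_three.2 ⟨a, b, p c, hab, n1, n2, rfl⟩
      omega
    · have hnab' : ¬ G.Adj b a := fun h => hnab h.symm
      have e1' : ¬ G.Adj (p c) a := fun h => e1 h.symm
      have e2' : ¬ G.Adj (p c) b := fun h => e2 h.symm
      rintro u (rfl | rfl | rfl) v (rfl | rfl | rfl) <;> first | assumption | exact G.irrefl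
    · rintro s (rfl | rfl | rfl)
      · exact XI _ ha
      · exact XI _ hb
      · exact PI _ hc
  by_cases hP : ∀ x ∈ X, ∀ y ∈ X, ¬ G.Adj (p x) (p y)
  · left
    refine aux_replace G D X (p '' X) ?_ ?_ indI ?_
    · rw [Set.ncard_image_of_injOn (fun x hx y hy h => pinj x hx y hy h)]
    · rintro _ ⟨x, hx, rfl⟩ _ ⟨y, hy, rfl⟩
      exact hP x hx y hy
    · rintro _ ⟨x, hx, rfl⟩
      exact PI x hx
  push Not at hP
  obtain ⟨x, hx, y, hy, hpxy⟩ := hP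
  have hxy : x ≠ y := by
    rintro rfl
    exact G.irrefl hpxy
  by_cases hthird : ∃ z ∈ X, z ≠ x ∧ z ≠ y
  swap
  · left
    push Not at hthird
    have hsub : X ⊆ {x, y} := by
      intro z hz
      by_cases h : z = x
      · exact Or.inl h
      · exact Or.inr (hthird z hz h)
    have e1 := pna y hy x hx hxy
    refine aux_replace G D X {x, p y} ?_ ?_ indI ?_
    · have t1 := Set.ncard_le_ncard hsub (Set.toFinite _)
      rw [Set.ncard_pair hxy] at t1
      rw [Set.ncard_pair (pne y hy x (XD x hx))]
      exact t1
    · have e1' : ¬ G.Adj (p y) x := fun h => e1 h.symm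
      rintro u (rfl | rfl) v (rfl | rfl) <;> first | assumption | exact G.irrefl
    · rintro s (rfl | rfl)
      · exact XI _ hx
      · exact PI _ hy
  obtain ⟨z, hz, hzx, hzy⟩ := hthird
  have hsub : X ⊆ {x, y, z} := by
    intro w hw
    by_contra hcon
    simp only [Set.mem_insert_iff, Set.mem_singleton_iff, not_or] at hcon
    obtain ⟨hwx, hwy, hwz⟩ := hcon
    have hzw : ¬ G.Adj z w := fun h => F3 x hx y hy z hz w hw hpxy h hzx hzy hwx hwy
    have hpzw := F1 z hz w hw (Ne.symm hwz) hzw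
    have hnxy : ¬ G.Adj x y := fun h =>
      F3 z hz w hw x hx y hy hpzw h (Ne.symm hzx) (Ne.symm hwx) (Ne.symm hzy) (Ne.symm hwy)
    -- every vertex off the pair is adjacent to both of x, y
    have step : ∀ t ∈ X, t ≠ x → t ≠ y → G.Adj x t ∧ G.Adj y t := by
      intro t ht htx hty
      have off : ∀ s ∈ X, s ≠ x → s ≠ y → ¬ G.Adj s t := fun s hs h1 h3 h =>
        F3 x hx y hy s hs t ht hpxy h h1 h3 htx hty
      have adjn : ∀ u ∈ X, (u = x ∨ u = y) → G.Adj u t := by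
        intro u hu hux
        obtain ⟨s, hs, hus⟩ := nbr u hu
        have hsx : s ≠ x := by
          rintro rfl
          rcases hux with rfl | rfl
          · exact G.irrefl hus
          · exact hnxy hus.symm
        have hsy : s ≠ y := by
          rintro rfl
          rcases hux with rfl | rfl
          · exact hnxy hus
          · exact G.irrefl hus
        by_cases hts : t = s
        · exact hts ▸ hus
        have htu : t ≠ u := by rcases hux with rfl | rfl <;> assumption
        rcases F2 u hu s hs t ht hus htu hts with h | h
        · exact h
        · exact absurd h (off s hs hsx hsy)
      exact ⟨adjn x hx (Or.inl rfl), adjn y hy (Or.inr rfl)⟩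
    obtain ⟨hxz, hyz⟩ := step z hz hzx hzy
    obtain ⟨hxw, hyw⟩ := step w hw hwx hwy
    rcases h2 (p x) (p y) (p z) (p w) hpxy hpzw
      (fun h => hzx (pinj x hx z hz h).symm) (fun h => hwx (pinj x hx w hw h).symm)
      (fun h => hzy (pinj y hy z hz h).symm) (fun h => hwy (pinj y hy w hw h).symm)
      with h | h | h | h
    · exact F3 x hx z hz y hy w hw h hyw (Ne.symm hxy) (Ne.symm hzy) hwx hwz
    · exact F3 x hx w hw y hy z hz h hyz (Ne.symm hxy) (Ne.symm hwy) hzx (Ne.symm hwz)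
    · exact F3 y hy z hz x hx w hw h hxw hxy (Ne.symm hzx) hwy hwz
    · exact F3 y hy w hw x hx z hz h hxz hxy (Ne.symm hwx) hzy (Ne.symm hwz)
  by_cases hA : G.Adj x y
  swap
  · exact Or.inl (path x hx y hy z hz hxy hzx hzy hA hsub)
  by_cases hB : G.Adj x z
  swap
  · refine Or.inl (path x hx z hz y hy hzx.symm hxy.symm hzy.symm hB ?_)
    intro t ht
    rcases hsub ht with h | h | h <;> rw [h] <;> simp
  by_cases hC : G.Adj y z
  swap
  · refine Or.inl (path y hy z hz x hx hzy.symm hxy hzx.symm hC ?_)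
    intro t ht
    rcases hsub ht with h | h | h <;> rw [h] <;> simp
  right
  refine ⟨x, y, z, hA, hB, hC, ?_⟩
  have hT : ∀ t ∈ ({x, y, z} : Set V), t ∈ X := by
    rintro t (rfl | rfl | rfl) <;> assumption
  ext v
  constructor
  · intro hv
    by_cases hvX : v ∈ X
    · exact Or.inl (hsub hvX)
    · exact Or.inr ⟨fun h => hvX (hT v h), fun u hu => iso v ⟨hv, hvX⟩ u (XD u (hT u hu))⟩
  · rintro (hv | ⟨hv1, hv2⟩)
    · exact XD v (hT v hv)
    · by_contra hvD
      obtain ⟨u, hu, huv⟩ := hD.1 v hvD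
      have huX : u ∉ X := fun h => hv2 u (hsub h) huv
      have k1 := iso u ⟨hu, huX⟩ x (XD x hx)
      have k2 := iso u ⟨hu, huX⟩ y (XD y hy)
      rcases h2 x y u v hA huv (fun h => huX (h ▸ hx)) (fun h => hvD (h ▸ XD x hx))
        (fun h => huX (h ▸ hy)) (fun h => hvD (h ▸ XD y hy)) with h | h | h | h
      · exact k1 h
      · exact hv2 x (by simp) h
      · exact k2 h
      · exact hv2 y (by simp) h

/-- For a `2K₂`-free graph `G`, the upper domination number `Γ(G)` equals the maximum of
`α(G)` and the largest cardinality of a set of the form `T ∪ A(T)` that is a minimal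
dominating set of `G`, where `T` ranges over the triangles of `G` (the supremum of the
empty set being `0`). -/
theorem twoK2Free_upperDomNum {V : Type*} [Fintype V] (G : SimpleGraph V)
    (h2 : TwoK2Free G) :
    upperDomNum G =
      max (indepNum G)
        (sSup {n | ∃ x y z : V, G.Adj x y ∧ G.Adj x z ∧ G.Adj y z ∧
          MinimalDominating G (({x, y, z} : Set V) ∪ antiNbhd G {x, y, z}) ∧
          (({x, y, z} : Set V) ∪ antiNbhd G {x, y, z}).ncard = n}) := by
  have hb : BddAbove {n | ∃ x y z : V, G.Adj x y ∧ G.Adj x z ∧ G.Adj y z ∧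
          MinimalDominating G (({x, y, z} : Set V) ∪ antiNbhd G {x, y, z}) ∧
          (({x, y, z} : Set V) ∪ antiNbhd G {x, y, z}).ncard = n} := by
    refine ⟨upperDomNum G, ?_⟩
    rintro n ⟨x, y, z, _, _, _, hm, rfl⟩
    exact aux_dom_le G _ hm
  apply le_antisymm
  · apply csSup_le'
    rintro n ⟨D, hD, rfl⟩
    rcases aux_main G h2 D hD with h | ⟨x, y, z, hxy, hxz, hyz, h⟩
    · exact le_max_of_le_left h
    · apply le_max_of_le_right
      exact le_csSup hb ⟨x, y, z, hxy, hxz, hyz, h ▸ hD, h ▸ rfl⟩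
  · apply max_le (aux_indep_dom G)
    apply csSup_le'
    rintro n ⟨x, y, z, _, _, _, hm, rfl⟩
    exact aux_dom_le G _ hm
end
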